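/- arXiv:math/9904099 — 4 statements merged into one kernel-verified Lean document; each statement's English description precedes it below -/
import Mathlib

section
/- For every real θ with π/2 − 2(n−1)π/k < θ < 3π/2 − 2(n−1)π/k, the limit as t → +∞ (t real) of g_n(t + iθ) · √k · exp(−iπ(n−1)/k) · exp(((k−1)/2)·(t + iθ)) · exp(−k·e^{2πi(n−1)/k}·e^{t+iθ}) equals 1. In other words, g^{(n)}(z) is asymptotic to (1/√k)·e^{iπ(n−1)/k}·z^{−(k−1)/2}·exp(k·e^{2πi(n−1)/k}·z) as z = e^x → ∞ in the sector π/2 − 2(n−1)π/k < arg z < 3π/2 − 2(n−1)π/k. -/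
open Complex Real Filter

/-- The solution `g^{(n)}` of the generalized hypergeometric equation given by the
Mellin–Barnes integral of Lemma 5 of the paper, written in the logarithmic variable
`x` (`z = e^x`):
`g_n(x) = (2π)^{-(k+1)/2}·e^{-iπ(k/2-n-1)}·i·∫_ℝ Γ(c-iη)^k·e^{iπ(2(n-1)-k)(-c+iη)}·e^{k(-c+iη)x} dη`. -/
noncomputable def gMB (k n : ℕ) (c : ℝ) (x : ℂ) : ℂ :=
  (((2 * π : ℝ) ^ (-(((k : ℝ) + 1) / 2)) : ℝ) : ℂ) *
    Complex.exp (-Complex.I * (π : ℂ) * ((k : ℂ) / 2 - (n : ℂ) - 1)) * Complex.I *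
    ∫ η : ℝ,
      Complex.Gamma ((c : ℂ) - Complex.I * η) ^ k *
        Complex.exp (Complex.I * (π : ℂ) * (2 * ((n : ℂ) - 1) - (k : ℂ)) *
          (-(c : ℂ) + Complex.I * η)) *
        Complex.exp ((k : ℂ) * (-(c : ℂ) + Complex.I * η) * x)

theorem integrable_exp_neg_mul_abs {δ : ℝ} (hδ : 0 < δ) :
    MeasureTheory.Integrable fun x : ℝ => Real.exp (-δ * |x|) := by
  rw [← MeasureTheory.integrableOn_univ, ← Set.Iic_union_Ioi (a := (0 : ℝ))]
  refine MeasureTheory.IntegrableOn.union ?_ ?_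
  · refine (integrableOn_exp_mul_Iic hδ 0).congr_fun (fun x hx => ?_) measurableSet_Iic
    simp [abs_of_nonpos (Set.mem_Iic.1 hx)]
  · refine (integrableOn_exp_mul_Ioi (neg_neg_of_pos hδ) 0).congr_fun (fun x hx => ?_)
      measurableSet_Ioi
    simp [abs_of_pos (Set.mem_Ioi.1 hx)]

/-- Shifting the contour between two horizontal lines. -/
theorem integral_horizontal_eq {f : ℂ → ℂ} {a b C δ : ℝ} (hδ : 0 < δ)
    (hf : DifferentiableOn ℂ f {z | z.im ∈ Set.uIcc a b})
    (hbound : ∀ x : ℝ, ∀ y ∈ Set.uIcc a b, ‖f (x + y * I)‖ ≤ C * Real.exp (-δ * |x|)) :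
    ∫ x : ℝ, f (x + a * I) = ∫ x : ℝ, f (x + b * I) := by
  have hinteg : ∀ y ∈ Set.uIcc a b, MeasureTheory.Integrable fun x : ℝ => f (x + y * I) := by
    intro y hy
    refine MeasureTheory.Integrable.mono' ((integrable_exp_neg_mul_abs hδ).const_mul C) ?_
      (Eventually.of_forall fun x => hbound x y hy)
    refine Continuous.aestronglyMeasurable ?_
    exact hf.continuousOn.comp_continuous (by fun_prop) (by intro x; simpa using hy)
  have hrect : ∀ T : ℝ, (∫ x : ℝ in (-T)..T, f (x + a * I)) - (∫ x : ℝ in (-T)..T, f (x + b * I)) =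
      I • (∫ y : ℝ in a..b, f ((-T : ℝ) + y * I)) - I • ∫ y : ℝ in a..b, f (T + y * I) := by
    intro T
    have := integral_boundary_rect_eq_zero_of_differentiableOn f (-T + a * I) (T + b * I)
      (hf.mono fun z hz => by simpa using hz.2)
    simp at this
    push_cast
    simp only [smul_eq_mul]
    linear_combination this
  have hlim := (MeasureTheory.intervalIntegral_tendsto_integral (hinteg a Set.left_mem_uIcc)
    tendsto_neg_atTop_atBot tendsto_id).sub (MeasureTheory.intervalIntegral_tendsto_integral
    (hinteg b Set.right_mem_uIcc) tendsto_neg_atTop_atBot tendsto_id)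
  have hside : ∀ ε : ℝ → ℝ, (∀ T, |ε T| = |T|) →
      Tendsto (fun T : ℝ => I • ∫ y : ℝ in a..b, f (ε T + y * I)) atTop (nhds 0) := by
    intro ε hε
    refine squeeze_zero_norm (a := fun T : ℝ => C * Real.exp (-δ * |T|) * |b - a|) ?_ ?_
    · intro T
      rw [norm_smul, norm_I, one_mul]
      refine intervalIntegral.norm_integral_le_of_norm_le_const fun y hy => ?_
      simpa [hε] using hbound (ε T) y (Set.uIoc_subset_uIcc hy)
    · have : Tendsto (fun T : ℝ => Real.exp (-δ * |T|)) atTop (nhds 0) :=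
        Real.tendsto_exp_atBot.comp ((tendsto_abs_atTop_atTop).const_mul_atTop_of_neg (by linarith))
      simpa using (this.const_mul C).mul_const |b - a|
  have hzero := (hside (fun T => -T) (by simp)).sub (hside id (by simp))
  have := tendsto_nhds_unique hlim (hzero.congr fun T => (hrect T).symm)
  simpa [sub_eq_zero] using this

/-- The integrand of the Euler integral in the variable `u = log t` decays exponentially. -/
theorem exists_exp_mul_sub_exp_le {σ a : ℝ} (hσ : 0 < σ) (ha : 0 < a) :
    ∃ C : ℝ, ∀ u : ℝ, Real.exp (σ * u - a * Real.exp u) ≤ C * Real.exp (-σ * |u|) := by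
  set v := Real.log (2 * σ / a)
  have hv : Real.exp v = 2 * σ / a := Real.exp_log (by positivity)
  refine ⟨1 + Real.exp (2 * σ * (v - 1)), fun u => ?_⟩
  rcases le_total u 0 with hu | hu
  · rw [abs_of_nonpos hu]
    have : Real.exp (σ * u - a * Real.exp u) ≤ Real.exp (-σ * -u) := by
      apply Real.exp_le_exp.2
      nlinarith [Real.exp_pos u]
    nlinarith [Real.exp_pos (-σ * -u), Real.exp_pos (2 * σ * (v - 1))]
  · rw [abs_of_nonneg hu]
    have h1 : a * Real.exp u ≥ 2 * σ * (1 + u - v) := by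
      have : Real.exp u = Real.exp v * Real.exp (u - v) := by rw [← Real.exp_add]; ring_nf
      rw [this, hv]
      have h2 := Real.add_one_le_exp (u - v)
      have h3 : a * (2 * σ / a * Real.exp (u - v)) = 2 * σ * Real.exp (u - v) := by field_simp
      rw [h3]; nlinarith
    have : Real.exp (σ * u - a * Real.exp u) ≤ Real.exp (2 * σ * (v - 1)) * Real.exp (-σ * u) := by
      rw [← Real.exp_add]
      apply Real.exp_le_exp.2
      nlinarith
    nlinarith [Real.exp_pos (-σ * u)]

theorem integrable_exp_mul_sub_exp {σ a : ℝ} (hσ : 0 < σ) (ha : 0 < a) :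
    MeasureTheory.Integrable fun u : ℝ => Real.exp (σ * u - a * Real.exp u) := by
  obtain ⟨C, hC⟩ := exists_exp_mul_sub_exp_le hσ ha
  refine MeasureTheory.Integrable.mono' ((integrable_exp_neg_mul_abs hσ).const_mul C)
    (by fun_prop) (Eventually.of_forall fun u => ?_)
  rw [Real.norm_of_nonneg (Real.exp_pos _).le]
  exact hC u

theorem Gamma_eq_integral_exp {s : ℂ} (hs : 0 < s.re) :
    Complex.Gamma s = ∫ u : ℝ, Complex.exp (s * u - Complex.exp u) := by
  rw [Complex.Gamma_eq_integral hs, Complex.GammaIntegral]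
  rw [← Real.range_exp, ← Set.image_univ, MeasureTheory.integral_image_eq_integral_abs_deriv_smul
    MeasurableSet.univ (fun x _ => (Real.hasDerivAt_exp x).hasDerivWithinAt)
    Real.exp_injective.injOn]
  simp only [MeasureTheory.Measure.restrict_univ]
  congr 1
  ext u
  rw [abs_of_pos (Real.exp_pos u), real_smul, ← Complex.ofReal_exp,
    Complex.cpow_def_of_ne_zero (by simp)]
  rw [← Complex.ofReal_log (Real.exp_pos u).le, Real.log_exp]
  push_cast
  rw [← Complex.exp_add, ← Complex.exp_add]
  ring_nf

theorem norm_exp_mul_sub_exp (s : ℂ) (u β : ℝ) :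
    ‖Complex.exp (s * (u + β * I) - Complex.exp (u + β * I))‖ =
      Real.exp (-(s.im * β)) * Real.exp (s.re * u - Real.cos β * Real.exp u) := by
  rw [Complex.norm_exp, ← Real.exp_add]
  congr 1
  simp [Complex.exp_re]
  ring

theorem cos_le_cos_of_mem_uIcc {β y : ℝ} (hβ : |β| ≤ π) (hy : y ∈ Set.uIcc 0 β) :
    Real.cos β ≤ Real.cos y := by
  rw [← Real.cos_abs β, ← Real.cos_abs y]
  have : |y| ≤ |β| := by
    rcases Set.mem_uIcc.1 hy with h | h
    · rw [abs_of_nonneg h.1, abs_of_nonneg (h.1.trans h.2)]; exact h.2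
    · rw [abs_of_nonpos h.2, abs_of_nonpos (h.1.trans h.2)]; linarith
  exact Real.cos_le_cos_of_nonneg_of_le_pi (abs_nonneg _) hβ this

/-- Euler's integral on a rotated ray. -/
theorem Gamma_eq_integral_exp_rotated {s : ℂ} (hs : 0 < s.re) {β : ℝ} (hβ : |β| < π / 2) :
    Complex.Gamma s = ∫ u : ℝ, Complex.exp (s * (u + β * I) - Complex.exp (u + β * I)) := by
  have hcos : 0 < Real.cos β := Real.cos_pos_of_mem_Ioo (abs_lt.1 hβ)
  obtain ⟨C, hC⟩ := exists_exp_mul_sub_exp_le hs hcos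
  have := integral_horizontal_eq (f := fun z => Complex.exp (s * z - Complex.exp z)) (a := 0)
    (b := β) (C := Real.exp (|s.im| * |β|) * C) hs
    (by fun_prop) ?_
  · rw [Gamma_eq_integral_exp hs]
    simpa using this
  · intro u y hy
    rw [norm_exp_mul_sub_exp, mul_assoc]
    have hyβ : |y| ≤ |β| := by simpa using Set.abs_sub_left_of_mem_uIcc hy
    refine mul_le_mul (Real.exp_le_exp.2 ?_) (le_trans (Real.exp_le_exp.2 ?_) (hC u))
      (Real.exp_pos _).le (Real.exp_pos _).le
    · calc -(s.im * y) ≤ |s.im * y| := neg_le_abs _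
        _ = |s.im| * |y| := abs_mul _ _
        _ ≤ _ := by gcongr
    · have := cos_le_cos_of_mem_uIcc (by linarith [Real.pi_pos]) hy
      gcongr

/-- Euler's integral for `Γ(s) w ^ (-s)`, where `w = exp y` lies in the right half plane. -/
theorem Gamma_mul_exp_neg_eq_integral {s y : ℂ} (hs : 0 < s.re) (hy : |y.im| < π / 2) :
    Complex.Gamma s * Complex.exp (-s * y) =
      ∫ u : ℝ, Complex.exp (s * u - Complex.exp y * Complex.exp u) := by
  rw [Gamma_eq_integral_exp_rotated hs hy, ← MeasureTheory.integral_mul_const,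
    ← MeasureTheory.integral_add_right_eq_self _ y.re]
  congr 1
  ext u
  have : ((u + y.re : ℝ) : ℂ) + y.im * I = u + y := by
    conv_rhs => rw [← Complex.re_add_im y]
    push_cast; ring
  rw [this, ← Complex.exp_add, Complex.exp_add (u : ℂ) y]
  ring_nf

/-- `Γ` decays exponentially along vertical lines, at any rate less than `π / 2`, uniformly on
vertical strips in the right half plane. -/
theorem exists_norm_Gamma_le {p q β : ℝ} (hp : 0 < p) (hq : 0 < q) (hβ0 : 0 ≤ β) (hβ : β < π / 2) :
    ∃ C : ℝ, ∀ s : ℂ, s.re ∈ Set.uIcc p q →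
      ‖Complex.Gamma s‖ ≤ C * Real.exp (-β * |s.im|) := by
  have hcos : 0 < Real.cos β := Real.cos_pos_of_mem_Ioo ⟨by linarith [Real.pi_pos], hβ⟩
  have hip := integrable_exp_mul_sub_exp hp hcos
  have hiq := integrable_exp_mul_sub_exp hq hcos
  refine ⟨∫ u : ℝ, (Real.exp (p * u - Real.cos β * Real.exp u) +
    Real.exp (q * u - Real.cos β * Real.exp u)), fun s hs => ?_⟩
  have hs0 : 0 < s.re := (lt_min hp hq).trans_le hs.1
  obtain ⟨γ, hγ, hγs⟩ : ∃ γ : ℝ, |γ| = β ∧ s.im * γ = β * |s.im| := by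
    rcases le_total 0 s.im with h | h
    · exact ⟨β, abs_of_nonneg hβ0, by rw [abs_of_nonneg h, mul_comm]⟩
    · exact ⟨-β, by rw [abs_neg, abs_of_nonneg hβ0], by rw [abs_of_nonpos h]; ring⟩
  rw [Gamma_eq_integral_exp_rotated hs0 (hγ.trans_lt hβ), mul_comm (∫ u : ℝ, _ : ℝ),
    ← MeasureTheory.integral_const_mul]
  refine MeasureTheory.norm_integral_le_of_norm_le ((hip.add hiq).const_mul _)
    (Eventually.of_forall fun u => ?_)
  rw [norm_exp_mul_sub_exp, hγs, ← Real.cos_abs γ, hγ, neg_mul]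
  gcongr
  have : s.re * u ≤ p * u ∨ s.re * u ≤ q * u := by
    rcases Set.mem_uIcc.1 hs with h | h <;> rcases le_total 0 u with hu | hu
    · right; nlinarith
    · left; nlinarith
    · left; nlinarith
    · right; nlinarith
  rcases this with h | h
  · exact (Real.exp_le_exp.2 (by linarith)).trans (le_add_of_nonneg_right (Real.exp_pos _).le)
  · exact (Real.exp_le_exp.2 (by linarith)).trans (le_add_of_nonneg_left (Real.exp_pos _).le)

/-- The Mellin--Barnes integral does not depend on the vertical line of integration. -/
theorem integral_Gamma_pow_vertical_eq {k : ℕ} (hk : 1 ≤ k) {y : ℂ} (hy : |y.im| < π / 2)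
    {p q : ℝ} (hp : 0 < p) (hq : 0 < q) :
    ∫ η : ℝ, (Complex.Gamma (p - I * η) * Complex.exp (-(p - I * η) * y)) ^ k =
      ∫ η : ℝ, (Complex.Gamma (q - I * η) * Complex.exp (-(q - I * η) * y)) ^ k := by
  set β := (|y.im| + π / 2) / 2 with hβ
  obtain ⟨C, hC⟩ := exists_norm_Gamma_le (β := β) hp hq (by positivity) (by linarith)
  have hδ : 0 < k * (β - |y.im|) := mul_pos (by exact_mod_cast hk) (by linarith)
  set B := Real.exp (max (-p * y.re) (-q * y.re))
  have := integral_horizontal_eq (a := p) (b := q) (C := (C * B) ^ k)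
    (f := fun z => (Complex.Gamma (-I * z) * Complex.exp (-(-I * z) * y)) ^ k) hδ ?_ ?_
  · have hz : ∀ (p η : ℝ), -I * (η + p * I) = p - I * η := fun p η => by
      linear_combination (-(p : ℂ)) * I_mul_I
    simpa only [hz] using this
  · intro z hz
    have hre : 0 < (-I * z).re := by
      simpa using (lt_min hp hq).trans_le hz.1
    refine DifferentiableAt.differentiableWithinAt ?_
    have h1 : DifferentiableAt ℂ Complex.Gamma (-I * z) :=
      Complex.differentiableAt_Gamma _ fun m hm => by
        rw [hm] at hre
        simp at hre
        linarith [(Nat.cast_nonneg m : (0 : ℝ) ≤ m)]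
    have h2 : DifferentiableAt ℂ (fun z => Complex.Gamma (-I * z)) z :=
      DifferentiableAt.comp z h1 (by fun_prop)
    fun_prop
  · intro x v hv
    have hre : (-I * (x + v * I)).re = v := by simp
    have him : (-I * (x + v * I)).im = -x := by simp
    have hG := hC (-I * (x + v * I)) (by rwa [hre])
    rw [him, abs_neg] at hG
    have hE : ‖Complex.exp (-(-I * (x + v * I)) * y)‖ ≤ B * Real.exp (|y.im| * |x|) := by
      rw [Complex.norm_exp, ← Real.exp_add]
      apply Real.exp_le_exp.2
      have h1 : (-(-I * (x + v * I)) * y).re = -v * y.re + -(x * y.im) := by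
        rw [Complex.mul_re, Complex.neg_re, Complex.neg_im, hre, him]; ring
      rw [h1]
      refine add_le_add ?_ ?_
      · rw [le_max_iff]
        rcases Set.mem_uIcc.1 hv with h | h <;> rcases le_total 0 y.re with hu | hu
        · left; nlinarith
        · right; nlinarith
        · right; nlinarith
        · left; nlinarith
      · rw [← abs_mul, mul_comm]; exact neg_le_abs _
    rw [norm_pow, norm_mul]
    calc _ ≤ (C * Real.exp (-β * |x|) * (B * Real.exp (|y.im| * |x|))) ^ k := by
          gcongr
          exact (norm_nonneg _).trans hG
      _ = _ := by
          rw [mul_mul_mul_comm, mul_pow, ← Real.exp_add, ← Real.exp_nat_mul]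
          ring_nf

/-- The phase `e ^ x - 1 - x` of the Euler integral at its saddle point, at scale `ρ`. -/
noncomputable def saddlePhase (ρ u : ℝ) : ℝ := ρ ^ 2 * (Real.exp (u / ρ) - 1 - u / ρ)

theorem saddlePhase_nonneg (ρ u : ℝ) : 0 ≤ saddlePhase ρ u :=
  mul_nonneg (sq_nonneg ρ) (by linarith [Real.add_one_le_exp (u / ρ)])

theorem abs_sub_one_le_saddlePhase {ρ : ℝ} (hρ : 1 ≤ ρ) (u : ℝ) :
    (|u| - 1) / 2 ≤ saddlePhase ρ u := by
  have hρ0 : 0 < ρ := by linarith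
  rcases le_total 0 u with hu | hu
  · have h := Real.quadratic_le_exp_of_nonneg (div_nonneg hu hρ0.le)
    have h2 : ρ ^ 2 * ((u / ρ) ^ 2 / 2) ≤ saddlePhase ρ u :=
      mul_le_mul_of_nonneg_left (by linarith) (sq_nonneg ρ)
    have h3 : ρ ^ 2 * ((u / ρ) ^ 2 / 2) = u ^ 2 / 2 := by field_simp
    rw [abs_of_nonneg hu]
    nlinarith [sq_nonneg (u - 1)]
  · rw [abs_of_nonpos hu]
    rcases le_total (-u) 1 with hu1 | hu1
    · linarith [saddlePhase_nonneg ρ u]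
    set y := 1 / ρ with hy
    have hy0 : 0 < y := by positivity
    have hy1 : y ≤ 1 := by rw [hy, div_le_one hρ0]; exact hρ
    have hE : Real.exp (-y) ≤ 1 - y / 2 := by
      rw [Real.exp_neg, inv_le_comm₀ (Real.exp_pos y) (by linarith)]
      refine le_trans ?_ (Real.add_one_le_exp y)
      rw [inv_le_iff_one_le_mul₀ (by linarith)]
      nlinarith
    have hE2 := Real.add_one_le_exp (-y)
    have htangent : Real.exp (-y) * (1 + (u * y + y)) ≤ Real.exp (u / ρ) := by
      have : Real.exp (u / ρ) = Real.exp (-y) * Real.exp (u * y + y) := by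
        rw [← Real.exp_add, hy]; ring_nf
      rw [this]
      exact mul_le_mul_of_nonneg_left (by linarith [Real.add_one_le_exp (u * y + y)])
        (Real.exp_pos _).le
    have hlow : (-u - 1) * y ^ 2 / 2 ≤ Real.exp (u / ρ) - 1 - u / ρ := by
      have : u / ρ = u * y := by rw [hy]; ring
      rw [this] at htangent ⊢
      nlinarith [mul_nonneg (mul_nonneg (by linarith : 0 ≤ -u - 1) hy0.le)
        (by linarith : 0 ≤ 1 - y / 2 - Real.exp (-y))]
    have hρy : ρ * y = 1 := by rw [hy]; field_simp
    calc (-u - 1) / 2 = ρ ^ 2 * ((-u - 1) * y ^ 2 / 2) := by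
          linear_combination (-(-u - 1) / 2 * (ρ * y + 1)) * hρy
      _ ≤ saddlePhase ρ u := mul_le_mul_of_nonneg_left hlow (sq_nonneg ρ)

theorem exp_div_le_saddlePhase {ρ : ℝ} (hρ : 1 ≤ ρ) (u : ℝ) :
    Real.exp (u / ρ) ≤ 3 * (1 + saddlePhase ρ u) := by
  have hρ0 : 0 < ρ := by linarith
  have h1 : Real.exp (u / ρ) - 1 - u / ρ ≤ saddlePhase ρ u :=
    le_mul_of_one_le_left (by linarith [Real.add_one_le_exp (u / ρ)]) (by nlinarith)
  have h2 : u / ρ ≤ |u| := (div_le_div_of_nonneg_right (le_abs_self u) hρ0.le).trans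
    (div_le_self (abs_nonneg u) hρ)
  linarith [abs_sub_one_le_saddlePhase hρ u]

theorem abs_exp_div_sub_one_le_saddlePhase {ρ : ℝ} (hρ : 1 ≤ ρ) (u : ℝ) :
    |ρ * (Real.exp (u / ρ) - 1)| ≤ 3 * (1 + saddlePhase ρ u) := by
  have hρ0 : 0 < ρ := by linarith
  have h0 : 0 ≤ Real.exp (u / ρ) - 1 - u / ρ := by linarith [Real.add_one_le_exp (u / ρ)]
  have h1 : ρ * (Real.exp (u / ρ) - 1 - u / ρ) ≤ saddlePhase ρ u :=
    mul_le_mul_of_nonneg_right (by nlinarith) h0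
  have h2 : ρ * (Real.exp (u / ρ) - 1) = ρ * (Real.exp (u / ρ) - 1 - u / ρ) + u := by
    field_simp; ring
  have h3 := mul_nonneg hρ0.le h0
  rw [h2]
  refine (abs_add_le _ _).trans ?_
  rw [abs_of_nonneg h3]
  linarith [abs_sub_one_le_saddlePhase hρ u]

theorem hasDerivAt_saddlePhase {ρ : ℝ} (hρ : ρ ≠ 0) (u : ℝ) :
    HasDerivAt (saddlePhase ρ) (ρ * (Real.exp (u / ρ) - 1)) u := by
  have h := ((hasDerivAt_id u).div_const ρ)
  refine (((h.exp.sub_const 1).sub h).const_mul (ρ ^ 2)).congr_deriv ?_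
  simp only [id]
  field_simp

theorem hasDerivAt_exp_div_sub_one {ρ : ℝ} (hρ : ρ ≠ 0) (u : ℝ) :
    HasDerivAt (fun u => ρ * (Real.exp (u / ρ) - 1)) (Real.exp (u / ρ)) u := by
  have h := ((hasDerivAt_id u).div_const ρ)
  refine ((h.exp.sub_const 1).const_mul ρ).congr_deriv ?_
  simp only [id]
  field_simp

theorem continuous_saddlePhase (ρ : ℝ) : Continuous (saddlePhase ρ) := by
  unfold saddlePhase
  fun_prop

theorem tendsto_saddlePhase (u : ℝ) :
    Tendsto (fun ρ => saddlePhase ρ u) atTop (nhds (u ^ 2 / 2)) := by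
  rw [tendsto_iff_norm_sub_tendsto_zero]
  refine squeeze_zero' (g := fun ρ => |u| ^ 3 / ρ) (Eventually.of_forall fun _ => norm_nonneg _) ?_
    (tendsto_const_nhds.div_atTop tendsto_id)
  filter_upwards [eventually_ge_atTop (max 1 |u|)] with ρ hρ
  have hρ1 : 1 ≤ ρ := (le_max_left _ _).trans hρ
  have hρ0 : 0 < ρ := by linarith
  have hx : |u / ρ| ≤ 1 := by
    rw [abs_div, abs_of_pos hρ0, div_le_one hρ0]; exact (le_max_right _ _).trans hρ
  have h := Real.exp_bound hx (n := 3) (by norm_num)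
  simp only [Finset.sum_range_succ, Finset.sum_range_zero] at h
  norm_num [Nat.factorial] at h
  have h2 : saddlePhase ρ u - u ^ 2 / 2 =
      ρ ^ 2 * (Real.exp (u / ρ) - (1 + u / ρ + (u / ρ) ^ 2 / 2)) := by
    unfold saddlePhase; field_simp; ring
  rw [h2, Real.norm_eq_abs, abs_mul, abs_of_pos (by positivity : 0 < ρ ^ 2)]
  calc _ ≤ ρ ^ 2 * (|u / ρ| ^ 3 * (2 / 9)) := by gcongr
    _ = |u| ^ 3 / ρ * (2 / 9) := by rw [abs_div, abs_of_pos hρ0]; field_simp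
    _ ≤ |u| ^ 3 / ρ := by
      have : 0 ≤ |u| ^ 3 / ρ := by positivity
      linarith

theorem exists_saddlePhase_bound {a : ℝ} (ha : 0 < a) :
    ∃ D : ℝ, 0 ≤ D ∧ ∀ ρ : ℝ, 1 ≤ ρ → ∀ u : ℝ,
      (1 + saddlePhase ρ u) ^ 2 * Real.exp (-a * saddlePhase ρ u) ≤
        D * Real.exp (-(a / 4) * |u|) := by
  refine ⟨(1 + 4 / a) ^ 2 * Real.exp (a / 4), by positivity, fun ρ hρ u => ?_⟩
  set P := saddlePhase ρ u
  have hP : 0 ≤ P := saddlePhase_nonneg ρ u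
  have h1 : 1 + P ≤ (1 + 4 / a) * Real.exp (a * P / 4) := by
    have := Real.add_one_le_exp (a * P / 4)
    calc 1 + P ≤ (1 + 4 / a) * (a * P / 4 + 1) := by
          have : (1 + 4 / a) * (a * P / 4 + 1) = 1 + P + (a * P / 4 + 4 / a) := by field_simp; ring
          rw [this]
          have : 0 ≤ a * P / 4 + 4 / a := by positivity
          linarith
      _ ≤ _ := by gcongr
  calc (1 + P) ^ 2 * Real.exp (-a * P)
      ≤ ((1 + 4 / a) * Real.exp (a * P / 4)) ^ 2 * Real.exp (-a * P) := by gcongr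
    _ = (1 + 4 / a) ^ 2 * Real.exp (-a * P / 2) := by
        rw [mul_pow, ← Real.exp_nat_mul, mul_assoc, ← Real.exp_add]; push_cast; ring_nf
    _ ≤ (1 + 4 / a) ^ 2 * Real.exp (a / 4 + -(a / 4) * |u|) := by
        gcongr
        nlinarith [abs_sub_one_le_saddlePhase hρ u]
    _ = _ := by rw [Real.exp_add]; ring

/-- The oscillatory integral with phase `saddlePhase`, as a function of the frequency. -/
noncomputable def saddleIntegral (b : ℂ) (ρ η : ℝ) : ℂ :=
  ∫ u : ℝ, Complex.exp (-b * saddlePhase ρ u) * Complex.exp (-I * η * u)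

theorem norm_exp_neg_mul_saddlePhase (b : ℂ) (ρ u : ℝ) :
    ‖Complex.exp (-b * saddlePhase ρ u)‖ = Real.exp (-b.re * saddlePhase ρ u) := by
  rw [Complex.norm_exp]; simp

theorem norm_exp_neg_I_mul (η u : ℝ) : ‖Complex.exp (-I * η * u)‖ = 1 := by
  rw [Complex.norm_exp]; simp

theorem exists_norm_exp_saddlePhase_le {b : ℂ} (hb : 0 < b.re) :
    ∃ D : ℝ, 0 ≤ D ∧ ∀ ρ : ℝ, 1 ≤ ρ → ∀ u : ℝ,
      ‖Complex.exp (-b * saddlePhase ρ u)‖ ≤ D * Real.exp (-(b.re / 4) * |u|) ∧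
      ‖-b * (ρ * (Real.exp (u / ρ) - 1) : ℝ) * Complex.exp (-b * saddlePhase ρ u)‖ ≤
        D * Real.exp (-(b.re / 4) * |u|) ∧
      ‖(b ^ 2 * (ρ * (Real.exp (u / ρ) - 1) : ℝ) ^ 2 - b * (Real.exp (u / ρ) : ℝ)) *
          Complex.exp (-b * saddlePhase ρ u)‖ ≤ D * Real.exp (-(b.re / 4) * |u|) := by
  obtain ⟨D, hD0, hD⟩ := exists_saddlePhase_bound hb
  refine ⟨9 * (1 + ‖b‖) ^ 2 * D, by positivity, fun ρ hρ u => ?_⟩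
  have hP := saddlePhase_nonneg ρ u
  have h1 := abs_exp_div_sub_one_le_saddlePhase hρ u
  have h2 := exp_div_le_saddlePhase hρ u
  have hDu := hD ρ hρ u
  have key : ∀ x : ℂ, ‖x‖ ≤ 9 * (1 + ‖b‖) ^ 2 * (1 + saddlePhase ρ u) ^ 2 →
      ‖x * Complex.exp (-b * saddlePhase ρ u)‖ ≤
        9 * (1 + ‖b‖) ^ 2 * D * Real.exp (-(b.re / 4) * |u|) := by
    intro x hx
    rw [norm_mul, norm_exp_neg_mul_saddlePhase]
    calc _ ≤ 9 * (1 + ‖b‖) ^ 2 * (1 + saddlePhase ρ u) ^ 2 *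
          Real.exp (-b.re * saddlePhase ρ u) := by gcongr
      _ = 9 * (1 + ‖b‖) ^ 2 * ((1 + saddlePhase ρ u) ^ 2 *
          Real.exp (-b.re * saddlePhase ρ u)) := by ring
      _ ≤ 9 * (1 + ‖b‖) ^ 2 * (D * Real.exp (-(b.re / 4) * |u|)) := by gcongr
      _ = _ := by ring
  have hb0 := norm_nonneg b
  set P := saddlePhase ρ u
  set Q := 1 + P
  have hQ : 1 ≤ Q := by linarith
  have hbQ : 1 ≤ (1 + ‖b‖) * Q := by nlinarith
  refine ⟨by simpa using key 1 (by rw [norm_one]; nlinarith), key _ ?_, key _ ?_⟩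
  · rw [norm_mul, norm_neg, Complex.norm_real, Real.norm_eq_abs]
    calc ‖b‖ * |ρ * (Real.exp (u / ρ) - 1)| ≤ ‖b‖ * (3 * Q) := by gcongr
      _ ≤ 3 * ((1 + ‖b‖) * Q) := by nlinarith
      _ ≤ _ := by nlinarith
  · refine (norm_sub_le _ _).trans ?_
    rw [norm_mul, norm_mul, norm_pow, norm_pow, Complex.norm_real, Complex.norm_real,
      Real.norm_eq_abs, Real.norm_of_nonneg (Real.exp_pos _).le]
    calc _ ≤ ‖b‖ ^ 2 * (3 * Q) ^ 2 + ‖b‖ * (3 * Q) := by gcongr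
      _ ≤ _ := by
        nlinarith [mul_nonneg hb0 (by linarith : 0 ≤ Q),
          mul_nonneg (mul_nonneg hb0 (by linarith : 0 ≤ Q)) (by linarith : 0 ≤ Q - 1)]

theorem hasDerivAt_exp_neg_mul_saddlePhase (b : ℂ) {ρ : ℝ} (hρ : ρ ≠ 0) (u : ℝ) :
    HasDerivAt (fun u : ℝ => Complex.exp (-b * saddlePhase ρ u))
      (-b * (ρ * (Real.exp (u / ρ) - 1) : ℝ) * Complex.exp (-b * saddlePhase ρ u)) u := by
  refine (((hasDerivAt_saddlePhase hρ u).ofReal_comp.const_mul (-b)).cexp).congr_deriv ?_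
  ring

theorem sq_mul_saddleIntegral {b : ℂ} (hb : 0 < b.re) {ρ : ℝ} (hρ : 1 ≤ ρ) (η : ℝ) :
    (η : ℂ) ^ 2 * saddleIntegral b ρ η =
      -∫ u : ℝ, (b ^ 2 * (ρ * (Real.exp (u / ρ) - 1) : ℝ) ^ 2 - b * (Real.exp (u / ρ) : ℝ)) *
          Complex.exp (-b * saddlePhase ρ u) * Complex.exp (-I * η * u) := by
  have hρ0 : ρ ≠ 0 := by linarith
  obtain ⟨D, hD0, hD⟩ := exists_norm_exp_saddlePhase_le hb
  have hcont := continuous_saddlePhase ρ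
  have hdom := (integrable_exp_neg_mul_abs (by positivity : 0 < b.re / 4)).const_mul D
  set h : ℝ → ℂ := fun u => Complex.exp (-b * saddlePhase ρ u) with hh
  set h' : ℝ → ℂ := fun u => -b * (ρ * (Real.exp (u / ρ) - 1) : ℝ) * h u with hh'
  set h'' : ℝ → ℂ := fun u =>
    (b ^ 2 * (ρ * (Real.exp (u / ρ) - 1) : ℝ) ^ 2 - b * (Real.exp (u / ρ) : ℝ)) * h u with hh''
  set e : ℝ → ℂ := fun u => Complex.exp (-I * η * u) with he
  have hcontE : Continuous e := by fun_prop
  have hc0 : Continuous h := by fun_prop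
  have hc1 : Continuous h' := by fun_prop
  have hc2 : Continuous h'' := by fun_prop
  have hinteg : ∀ F : ℝ → ℂ, Continuous F →
      (∀ u, ‖F u‖ ≤ D * Real.exp (-(b.re / 4) * |u|)) →
      MeasureTheory.Integrable fun u => F u * e u := by
    intro F hF hFb
    refine hdom.mono' (by fun_prop) (Eventually.of_forall fun u => ?_)
    rw [norm_mul, norm_exp_neg_I_mul, mul_one]
    exact hFb u
  have hi0 := hinteg h hc0 fun u => (hD ρ hρ u).1
  have hi1 := hinteg h' hc1 fun u => (hD ρ hρ u).2.1
  have hi2 := hinteg h'' hc2 fun u => (hD ρ hρ u).2.2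
  have hd0 : ∀ u, HasDerivAt h (h' u) u := hasDerivAt_exp_neg_mul_saddlePhase b hρ0
  have hd1 : ∀ u, HasDerivAt h' (h'' u) u := fun u => by
    refine (((hasDerivAt_exp_div_sub_one hρ0 u).ofReal_comp.const_mul (-b)).mul
      (hd0 u)).congr_deriv ?_
    simp only [hh'', hh']
    ring
  have hde : ∀ u, HasDerivAt e (-I * η * e u) u := fun u => by
    refine (((hasDerivAt_id u).ofReal_comp.const_mul (-I * η)).cexp).congr_deriv ?_
    simp [he]
    ring
  have hzero := MeasureTheory.integral_eq_zero_of_hasDerivAt_of_integrable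
    (f := fun u => h' u * e u + I * η * (h u * e u))
    (f' := fun u => h'' u * e u + (η : ℂ) ^ 2 * (h u * e u)) ?_
    (hi2.add (hi0.const_mul _)) (hi1.add (hi0.const_mul _))
  · rw [MeasureTheory.integral_add hi2 (hi0.const_mul _), MeasureTheory.integral_const_mul] at hzero
    exact eq_neg_of_add_eq_zero_right hzero
  · intro u
    refine (((hd1 u).mul (hde u)).add (((hd0 u).mul (hde u)).const_mul (I * η))).congr_deriv ?_
    linear_combination (-(η : ℂ) ^ 2 * (h u * e u)) * I_sq

theorem exists_norm_saddleIntegral_le {b : ℂ} (hb : 0 < b.re) :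
    ∃ C : ℝ, 0 ≤ C ∧ ∀ ρ : ℝ, 1 ≤ ρ → ∀ η : ℝ, ‖saddleIntegral b ρ η‖ ≤ C * (1 + η ^ 2)⁻¹ := by
  obtain ⟨D, hD0, hD⟩ := exists_norm_exp_saddlePhase_le hb
  have hdom := (integrable_exp_neg_mul_abs (by positivity : 0 < b.re / 4)).const_mul D
  set M := ∫ u : ℝ, D * Real.exp (-(b.re / 4) * |u|)
  have hM : 0 ≤ M := MeasureTheory.integral_nonneg fun u => by positivity
  refine ⟨2 * M, by positivity, fun ρ hρ η => ?_⟩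
  have h0 : ‖saddleIntegral b ρ η‖ ≤ M := by
    refine MeasureTheory.norm_integral_le_of_norm_le hdom (Eventually.of_forall fun u => ?_)
    rw [norm_mul, norm_exp_neg_I_mul, mul_one]
    exact (hD ρ hρ u).1
  have h2 : η ^ 2 * ‖saddleIntegral b ρ η‖ ≤ M := by
    have : η ^ 2 * ‖saddleIntegral b ρ η‖ = ‖(η : ℂ) ^ 2 * saddleIntegral b ρ η‖ := by
      rw [norm_mul, norm_pow, Complex.norm_real, Real.norm_eq_abs, sq_abs]
    rw [this, sq_mul_saddleIntegral hb hρ, norm_neg]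
    refine MeasureTheory.norm_integral_le_of_norm_le hdom (Eventually.of_forall fun u => ?_)
    rw [norm_mul _ (Complex.exp (-I * η * u)), norm_exp_neg_I_mul, mul_one]
    exact (hD ρ hρ u).2.2
  rw [← div_eq_mul_inv, le_div_iff₀ (by positivity)]
  linarith

theorem continuous_saddleIntegral {b : ℂ} (hb : 0 < b.re) {ρ : ℝ} (hρ : 1 ≤ ρ) :
    Continuous (saddleIntegral b ρ) := by
  obtain ⟨D, hD0, hD⟩ := exists_norm_exp_saddlePhase_le hb
  have hdom := (integrable_exp_neg_mul_abs (by positivity : 0 < b.re / 4)).const_mul D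
  have hcont := continuous_saddlePhase ρ
  refine MeasureTheory.continuous_of_dominated (fun η => by fun_prop)
    (fun η => Eventually.of_forall fun u => ?_) hdom (Eventually.of_forall fun u => by fun_prop)
  rw [norm_mul, norm_exp_neg_I_mul, mul_one]
  exact (hD ρ hρ u).1

theorem tendsto_saddleIntegral {b : ℂ} (hb : 0 < b.re) (η : ℝ) :
    Tendsto (fun ρ => saddleIntegral b ρ η) atTop
      (nhds ((2 * π / b) ^ (1 / 2 : ℂ) * Complex.exp (-(1 / (2 * b)) * η ^ 2))) := by
  obtain ⟨D, hD0, hD⟩ := exists_norm_exp_saddlePhase_le hb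
  have hdom := (integrable_exp_neg_mul_abs (by positivity : 0 < b.re / 4)).const_mul D
  have hb0 : b ≠ 0 := fun h => by simp [h] at hb
  have hgauss := fourierIntegral_gaussian (b := b / 2) (by simpa using hb) (-(η : ℂ))
  have e1 : (π : ℂ) / (b / 2) = 2 * π / b := by field_simp
  have e2 : -(-(η : ℂ)) ^ 2 / (4 * (b / 2)) = -(1 / (2 * b)) * η ^ 2 := by field_simp; ring
  rw [e1, e2] at hgauss
  rw [← hgauss]
  refine MeasureTheory.tendsto_integral_filter_of_dominated_convergence _
    (Eventually.of_forall fun ρ => ?_) ?_ hdom (Eventually.of_forall fun u => ?_)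
  · have hcont := continuous_saddlePhase ρ
    fun_prop
  · filter_upwards [eventually_ge_atTop 1] with ρ hρ
    refine Eventually.of_forall fun u => ?_
    rw [norm_mul, norm_exp_neg_I_mul, mul_one]
    exact (hD ρ hρ u).1
  · have h := ((Complex.continuous_ofReal.tendsto _).comp (tendsto_saddlePhase u)).const_mul (-b)
    have h2 := (h.cexp).mul_const (Complex.exp (-I * η * u))
    convert! h2 using 2
    rw [mul_comm]
    push_cast
    ring_nf

theorem tendsto_integral_saddleIntegral_pow {k : ℕ} (hk : 1 ≤ k) {b : ℂ} (hb : 0 < b.re) :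
    Tendsto (fun ρ => ∫ η : ℝ, saddleIntegral b ρ η ^ k) atTop
      (nhds (((2 * π / b) ^ (1 / 2 : ℂ)) ^ k * (2 * π * b / k) ^ (1 / 2 : ℂ))) := by
  obtain ⟨C, hC0, hC⟩ := exists_norm_saddleIntegral_le hb
  have hb0 : b ≠ 0 := fun h => by simp [h] at hb
  have hk0 : (k : ℂ) ≠ 0 := by exact_mod_cast (by omega : k ≠ 0)
  have hre : 0 < ((k : ℂ) / (2 * b)).re := by
    have : (k : ℂ) / (2 * b) = ((k / 2 : ℝ) : ℂ) * b⁻¹ := by push_cast; field_simp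
    rw [this, Complex.re_ofReal_mul, Complex.inv_re]
    have : 0 < normSq b := Complex.normSq_pos.2 hb0
    have : (0 : ℝ) < k := by exact_mod_cast hk
    positivity
  have hgauss := integral_gaussian_complex hre
  have e1 : (π : ℂ) / (k / (2 * b)) = 2 * π * b / k := by field_simp
  rw [e1] at hgauss
  rw [← hgauss, ← MeasureTheory.integral_const_mul]
  refine MeasureTheory.tendsto_integral_filter_of_dominated_convergence
    (fun η => C ^ k * (1 + η ^ 2)⁻¹) ?_ ?_ (integrable_inv_one_add_sq.const_mul _)
    (Eventually.of_forall fun η => ?_)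
  · filter_upwards [eventually_ge_atTop 1] with ρ hρ
    exact ((continuous_saddleIntegral hb hρ).pow k).aestronglyMeasurable
  · filter_upwards [eventually_ge_atTop 1] with ρ hρ
    refine Eventually.of_forall fun η => ?_
    rw [norm_pow]
    calc _ ≤ (C * (1 + η ^ 2)⁻¹) ^ k := by gcongr; exact hC ρ hρ η
      _ = C ^ k * ((1 + η ^ 2)⁻¹) ^ k := mul_pow _ _ _
      _ ≤ C ^ k * (1 + η ^ 2)⁻¹ := by
        gcongr
        exact pow_le_of_le_one (by positivity) (inv_le_one_of_one_le₀ (by nlinarith)) (by omega)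
  · convert (tendsto_saddleIntegral hb η).pow k using 2
    rw [mul_pow, ← Complex.exp_nat_mul]
    congr 2
    field_simp

/-- The Gamma function near the saddle point `w = exp (t + φ I)` of `Γ(s) w ^ (-s)`. -/
theorem Gamma_saddle_eq {φ : ℝ} (hφ : |φ| < π / 2) {ρ t : ℝ} (hρ : 0 < ρ)
    (ht : Real.exp t = ρ ^ 2) (η : ℝ) :
    Complex.Gamma (Complex.exp (t + φ * I) - I * (ρ * η)) *
        Complex.exp (-(Complex.exp (t + φ * I) - I * (ρ * η)) * (t + φ * I)) =
      (ρ : ℂ)⁻¹ * Complex.exp (-Complex.exp (t + φ * I)) *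
        saddleIntegral (Complex.exp (φ * I)) ρ η := by
  have hρ0 : (ρ : ℂ) ≠ 0 := by exact_mod_cast hρ.ne'
  have hw : Complex.exp (t + φ * I) = ρ ^ 2 * Complex.exp (φ * I) := by
    rw [Complex.exp_add, ← Complex.ofReal_exp, ht]; push_cast; rfl
  have hs : 0 < (Complex.exp (t + φ * I) - I * (ρ * η)).re := by
    have := Real.cos_pos_of_mem_Ioo (abs_lt.1 hφ)
    simp [Complex.exp_re]
    positivity
  rw [Gamma_mul_exp_neg_eq_integral hs (by simpa using hφ)]
  set g : ℝ → ℂ := fun u => Complex.exp ((Complex.exp (t + φ * I) - I * (ρ * η)) * u -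
    Complex.exp (t + φ * I) * Complex.exp u) with hg
  have hscale := MeasureTheory.Measure.integral_comp_div g ρ
  rw [abs_of_pos hρ, real_smul] at hscale
  rw [eq_comm, ← eq_inv_mul_iff_mul_eq₀ hρ0] at hscale
  rw [hscale, mul_assoc, saddleIntegral]
  congr 1
  rw [← MeasureTheory.integral_const_mul]
  refine MeasureTheory.integral_congr_ae (Eventually.of_forall fun u => ?_)
  simp only [hg]
  rw [hw, ← Complex.exp_add, ← Complex.exp_add]
  congr 1
  simp only [saddlePhase]
  push_cast
  field_simp
  ring

theorem integral_Gamma_pow_eq_saddleIntegral {k : ℕ} (hk : 1 ≤ k) {φ : ℝ} (hφ : |φ| < π / 2)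
    {ρ t p : ℝ} (hρ : 0 < ρ) (ht : Real.exp t = ρ ^ 2) (hp : 0 < p) :
    ∫ η : ℝ, (Complex.Gamma (p - I * η) * Complex.exp (-(p - I * η) * (t + φ * I))) ^ k =
      ρ * ((ρ : ℂ)⁻¹ * Complex.exp (-Complex.exp (t + φ * I))) ^ k *
        ∫ η : ℝ, saddleIntegral (Complex.exp (φ * I)) ρ η ^ k := by
  have hρ0 : (ρ : ℂ) ≠ 0 := by exact_mod_cast hρ.ne'
  set w := Complex.exp (t + φ * I) with hw
  have hq : 0 < w.re := by
    have := Real.cos_pos_of_mem_Ioo (abs_lt.1 hφ)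
    simp [hw, Complex.exp_re]
    positivity
  rw [integral_Gamma_pow_vertical_eq hk (by simpa using hφ) hp hq]
  set g : ℝ → ℂ := fun η => (Complex.Gamma (w.re - I * η) *
    Complex.exp (-(w.re - I * η) * (t + φ * I))) ^ k with hg
  have hscale := MeasureTheory.Measure.integral_comp_mul_left (fun η => g (η - w.im)) ρ
  rw [MeasureTheory.integral_sub_right_eq_self g, abs_of_pos (inv_pos.2 hρ), real_smul,
    Complex.ofReal_inv, eq_inv_mul_iff_mul_eq₀ hρ0] at hscale
  rw [← hscale, mul_assoc]
  congr 1
  rw [← MeasureTheory.integral_const_mul]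
  refine MeasureTheory.integral_congr_ae (Eventually.of_forall fun η => ?_)
  have harg : (w.re : ℂ) - I * ((ρ * η - w.im : ℝ) : ℂ) = w - I * (ρ * η) := by
    conv_rhs => rw [← Complex.re_add_im w]
    push_cast
    ring
  simp only [hg]
  rw [harg, hw, Gamma_saddle_eq hφ hρ ht, mul_pow]

theorem mul_exp_cpow_half {r φ : ℝ} (hr : 0 < r) (hφ : |φ| < π) :
    ((r : ℂ) * Complex.exp (φ * I)) ^ (1 / 2 : ℂ) = Real.sqrt r * Complex.exp (φ * I / 2) := by
  have hφ' := abs_lt.1 hφ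
  rw [Complex.cpow_def_of_ne_zero (mul_ne_zero (by exact_mod_cast hr.ne') (Complex.exp_ne_zero _)),
    Complex.log_ofReal_mul hr (Complex.exp_ne_zero _),
    Complex.log_exp (by simpa using hφ'.1) (by simpa using hφ'.2.le), add_mul, Complex.exp_add]
  congr 1
  · rw [Real.sqrt_eq_rpow, Real.rpow_def_of_pos hr]
    push_cast
    rfl
  · ring_nf

/-- **Lemma 5 of the paper, asymptotic part.** Along any horizontal line `x = t + iθ` in the
strip `π/2 - 2(n-1)π/k < θ < 3π/2 - 2(n-1)π/k`, the solution `g^{(n)}` satisfies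
`g^{(n)}(z) ∼ (1/√k)·e^{iπ(n-1)/k}·z^{-(k-1)/2}·exp(k·e^{2πi(n-1)/k}·z)` as
`z = e^x → ∞`. -/
theorem mellin_barnes_asymptotics (k n : ℕ) (hk : 1 ≤ k) (hn1 : 1 ≤ n) (hnk : n ≤ k)
    (c : ℝ) (hc : 0 < c) :
    ∀ θ : ℝ, π / 2 - 2 * ((n : ℝ) - 1) * π / k < θ →
      θ < 3 * π / 2 - 2 * ((n : ℝ) - 1) * π / k →
      Tendsto (fun t : ℝ =>
        gMB k n c ((t : ℂ) + (θ : ℂ) * Complex.I) * (Real.sqrt k : ℂ) *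
          Complex.exp (-Complex.I * (π : ℂ) * ((n : ℂ) - 1) / k) *
          Complex.exp ((((k : ℂ) - 1) / 2) * ((t : ℂ) + (θ : ℂ) * Complex.I)) *
          Complex.exp (-(k : ℂ) * Complex.exp (2 * (π : ℂ) * Complex.I * ((n : ℂ) - 1) / k) *
            Complex.exp ((t : ℂ) + (θ : ℂ) * Complex.I)))
        atTop (nhds 1) := by
  intro θ hθ1 hθ2
  have hkR : (0 : ℝ) < k := by exact_mod_cast hk
  have hk0 : (k : ℂ) ≠ 0 := by exact_mod_cast hkR.ne'
  set φ : ℝ := θ + 2 * ((n : ℝ) - 1) * π / k - π with hφdef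
  have hφ : |φ| < π / 2 := abs_lt.2 ⟨by linarith, by linarith⟩
  have hφπ : |φ| < π := by linarith [Real.pi_pos]
  set b : ℂ := Complex.exp (φ * I) with hb
  have hbre : 0 < b.re := by
    simpa [hb, Complex.exp_re] using Real.cos_pos_of_mem_Ioo (abs_lt.1 hφ)
  have hexpπ : Complex.exp (π * I) = -1 := Complex.exp_pi_mul_I
  set A : ℂ := (((2 * π : ℝ) ^ (-(((k : ℝ) + 1) / 2)) : ℝ) : ℂ) with hA
  set K : ℂ := A * Real.sqrt k *
    Complex.exp (-I * π * (k / 2 - n - 1) + π / 2 * I + -I * π * (n - 1) / k +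
      (k - 1) / 2 * (θ * I)) with hK
  -- the phase and modulus constants cancel
  have hconst : K * (((2 * π / b) ^ (1 / 2 : ℂ)) ^ k * (2 * π * b / k) ^ (1 / 2 : ℂ)) = 1 := by
    have h1 : (2 * π / b) ^ (1 / 2 : ℂ) = Real.sqrt (2 * π) * Complex.exp (-φ * I / 2) := by
      have h := mul_exp_cpow_half (r := 2 * π) (φ := -φ) (by positivity) (by rwa [abs_neg])
      rw [Complex.ofReal_neg] at h
      rw [← h, hb, neg_mul, Complex.exp_neg]
      push_cast
      rfl
    have h2 : (2 * π * b / k) ^ (1 / 2 : ℂ) =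
        Real.sqrt (2 * π / k) * Complex.exp (φ * I / 2) := by
      have h := mul_exp_cpow_half (r := 2 * π / k) (φ := φ) (by positivity) hφπ
      rw [← h, hb]
      push_cast
      ring_nf
    have hmod : A * Real.sqrt k * ((Real.sqrt (2 * π) : ℂ) ^ k * Real.sqrt (2 * π / k)) = 1 := by
      rw [hA, ← ofReal_pow, ← ofReal_mul, ← ofReal_mul, ← ofReal_mul, ← ofReal_one,
        Real.sqrt_div (by positivity)]
      have hsk : Real.sqrt k ≠ 0 := by positivity
      have : (2 * π) ^ (-(((k : ℝ) + 1) / 2)) * (Real.sqrt (2 * π) ^ k * Real.sqrt (2 * π)) = 1 := by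
        rw [Real.sqrt_eq_rpow, ← Real.rpow_natCast, ← Real.rpow_mul (by positivity),
          ← Real.rpow_add (by positivity), ← Real.rpow_add (by positivity)]
        ring_nf
        exact Real.rpow_zero _
      refine congrArg Complex.ofReal (Eq.trans ?_ this)
      field_simp
    have hphase : Complex.exp (-I * π * (k / 2 - n - 1) + π / 2 * I + -I * π * (n - 1) / k +
        (k - 1) / 2 * (θ * I)) * (Complex.exp (-φ * I / 2) ^ k * Complex.exp (φ * I / 2)) = 1 := by
      rw [← Complex.exp_nat_mul, ← Complex.exp_add, ← Complex.exp_add]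
      refine (congrArg Complex.exp ?_).trans Complex.exp_two_pi_mul_I
      rw [hφdef]
      push_cast
      field_simp
      ring
    rw [h1, h2, hK, mul_pow]
    calc _ = (A * Real.sqrt k * ((Real.sqrt (2 * π) : ℂ) ^ k * Real.sqrt (2 * π / k))) *
          (Complex.exp (-I * π * (k / 2 - n - 1) + π / 2 * I + -I * π * (n - 1) / k +
            (k - 1) / 2 * (θ * I)) * (Complex.exp (-φ * I / 2) ^ k * Complex.exp (φ * I / 2))) := by
          ring
      _ = 1 := by rw [hmod, hphase, one_mul]
  have hρlim : Tendsto (fun t : ℝ => Real.exp (t / 2)) atTop atTop :=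
    Real.tendsto_exp_atTop.comp (tendsto_id.atTop_div_const (by norm_num))
  have hlim := ((tendsto_integral_saddleIntegral_pow hk hbre).comp hρlim).const_mul K
  rw [hconst] at hlim
  refine hlim.congr fun t => ?_
  set ρ := Real.exp (t / 2) with hρ
  have hρ0 : 0 < ρ := Real.exp_pos _
  have ht : Real.exp t = ρ ^ 2 := by rw [hρ, ← Real.exp_nat_mul]; push_cast; ring_nf
  have hinteg : ∀ η : ℝ, Complex.Gamma ((c : ℂ) - I * η) ^ k *
        Complex.exp (I * π * (2 * ((n : ℂ) - 1) - k) * (-(c : ℂ) + I * η)) *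
        Complex.exp ((k : ℂ) * (-(c : ℂ) + I * η) * (t + θ * I)) =
      (Complex.Gamma (c - I * η) * Complex.exp (-(c - I * η) * (t + φ * I))) ^ k := fun η => by
    rw [mul_assoc, ← Complex.exp_add, mul_pow, ← Complex.exp_nat_mul]
    congr 2
    rw [hφdef]
    push_cast
    field_simp
    ring
  have hw : -(k : ℂ) * Complex.exp (2 * π * I * ((n : ℂ) - 1) / k) * Complex.exp (t + θ * I) =
      k * Complex.exp (t + φ * I) := by
    have : (t : ℂ) + φ * I = 2 * π * I * ((n : ℂ) - 1) / k + (t + θ * I) - π * I := by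
      rw [hφdef]; push_cast; ring
    rw [this, Complex.exp_sub, Complex.exp_add (2 * π * I * ((n : ℂ) - 1) / k), hexpπ]
    ring
  have hpow : (ρ : ℂ) * (ρ : ℂ)⁻¹ ^ k * Complex.exp ((k - 1) / 2 * t) = 1 := by
    rw [hρ, Complex.ofReal_exp, ← Complex.exp_neg, ← Complex.exp_nat_mul, ← Complex.exp_add,
      ← Complex.exp_add]
    refine (congrArg Complex.exp ?_).trans Complex.exp_zero
    push_cast
    ring
  have hI : I = Complex.exp (π / 2 * I) := Complex.exp_pi_div_two_mul_I.symm
  have hcancel : Complex.exp (-Complex.exp (t + φ * I)) ^ k *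
      Complex.exp (k * Complex.exp (t + φ * I)) = 1 := by
    rw [← Complex.exp_nat_mul, ← Complex.exp_add]
    refine (congrArg Complex.exp ?_).trans Complex.exp_zero
    ring
  simp only [gMB, hinteg, Function.comp]
  rw [integral_Gamma_pow_eq_saddleIntegral hk hφ hρ0 ht hc, hw, hK, ← hA, mul_add ((k - 1 : ℂ) / 2),
    Complex.exp_add ((k - 1 : ℂ) / 2 * t), Complex.exp_add, Complex.exp_add, Complex.exp_add,
    ← hI, mul_pow]
  set J := ∫ η : ℝ, saddleIntegral b ρ η ^ k
  linear_combination (-(A * Real.sqrt k * Complex.exp (-I * π * (k / 2 - n - 1)) * I *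
    Complex.exp (-I * π * (n - 1) / k) * Complex.exp ((k - 1) / 2 * (θ * I)) * J)) *
      (hcancel + Complex.exp (-Complex.exp (t + φ * I)) ^ k *
        Complex.exp (k * Complex.exp (t + φ * I)) * hpow)
end

section
/- Let φ : ℂ → ℂ be an entire (everywhere complex differentiable) function satisfying φ^{(k)}(x) = k^k · e^{kx} · φ(x) for all x ∈ ℂ, where φ^{(k)} is the k-th derivative. Then for every x ∈ ℂ, Σ_{m=0}^{k} (−1)^m · binom(k, m) · φ(x + 2πim/k) = 0. -/
open Complex Real

/-- The derivatives of `g` at `x` of order `j < k`, the `j`-th one weighted by `4 ^ j`. -/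
noncomputable def weightedJet (k : ℕ) (g : ℂ → ℂ) (x : ℂ) : Fin k → ℂ :=
  fun j => 4 ^ (j : ℕ) * iteratedDeriv j g x

lemma Differentiable.hasDerivAt_iteratedDeriv {g : ℂ → ℂ} (hg : Differentiable ℂ g)
    (n : ℕ) (x : ℂ) : HasDerivAt (iteratedDeriv n g) (iteratedDeriv (n + 1) g x) x := by
  have h : Differentiable ℂ (iteratedDeriv n g) :=
    (hg.contDiff (n := n + 1)).differentiable_iteratedDeriv n (by exact_mod_cast n.lt_succ_self)
  rw [iteratedDeriv_succ]
  exact (h x).hasDerivAt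

lemma Differentiable.fwdDiff {g : ℂ → ℂ} (hg : Differentiable ℂ g) (h : ℂ) :
    Differentiable ℂ (fwdDiff h g) := by
  unfold _root_.fwdDiff
  fun_prop

lemma Differentiable.fwdDiff_iterate {g : ℂ → ℂ} (hg : Differentiable ℂ g) (h : ℂ) (n : ℕ) :
    Differentiable ℂ ((_root_.fwdDiff h)^[n] g) := by
  induction n with
  | zero => exact hg
  | succ n ih =>
    rw [Function.iterate_succ_apply']
    exact ih.fwdDiff h

lemma iteratedDeriv_fwdDiff {g : ℂ → ℂ} (hg : Differentiable ℂ g) (h : ℂ) (n : ℕ) :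
    iteratedDeriv n (fwdDiff h g) = fwdDiff h (iteratedDeriv n g) := by
  funext x
  have hs : Differentiable ℂ fun z => g (z + h) := by fun_prop
  unfold fwdDiff
  rw [iteratedDeriv_fun_sub hs.contDiff.contDiffAt hg.contDiff.contDiffAt,
    iteratedDeriv_comp_add_const]

/-- The `n`-th forward difference is controlled by the `n`-th derivative. -/
lemma norm_fwdDiff_iterate_le {g : ℂ → ℂ} (hg : Differentiable ℂ g) (h x : ℂ) (n : ℕ) {M : ℝ}
    (hM : ∀ t ∈ Set.Icc (0 : ℝ) n, ‖iteratedDeriv n g (x + t * h)‖ ≤ M) :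
    ‖(fwdDiff h)^[n] g x‖ ≤ M * ‖h‖ ^ n := by
  induction n generalizing g M with
  | zero => simpa using hM 0 (by simp)
  | succ n ih =>
    rw [Function.iterate_succ_apply, pow_succ', ← mul_assoc]
    refine ih (hg.fwdDiff h) fun t ht => ?_
    rw [iteratedDeriv_fwdDiff hg]
    have key := Convex.norm_image_sub_le_of_norm_deriv_le (f := iteratedDeriv n g) (C := M)
      (fun z _ => (hg.hasDerivAt_iteratedDeriv n z).differentiableAt) (fun z hz => ?_)
      (convex_segment (𝕜 := ℝ) (x + t * h) (x + t * h + h))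
      (left_mem_segment ℝ _ _) (right_mem_segment ℝ _ _)
    · simpa [fwdDiff] using key
    · rw [segment_eq_image'] at hz
      obtain ⟨θ, hθ, rfl⟩ := hz
      rw [← iteratedDeriv_succ]
      have harg : x + t * h + θ • (x + t * h + h - (x + t * h)) = x + (t + θ : ℝ) * h := by
        rw [add_sub_cancel_left, real_smul]
        push_cast
        ring
      beta_reduce
      rw [harg]
      exact hM (t + θ) ⟨by linarith [ht.1, hθ.1], by push_cast; linarith [ht.2, hθ.2]⟩

/-- Far enough to the left, the jet of a solution varies at exponential rate at most `1 / 4`. -/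
lemma norm_weightedJet_le {k : ℕ} {g : ℂ → ℂ} (hg : Differentiable ℂ g)
    (hode : ∀ x : ℂ, iteratedDeriv k g x = (k : ℂ) ^ k * Complex.exp ((k : ℂ) * x) * g x)
    {X : ℝ} (hX : 4 * k * Real.exp X ≤ 1) {z w : ℂ} (hz : z.re ≤ X) (hw : w.re ≤ X) :
    ‖weightedJet k g w‖ ≤ ‖weightedJet k g z‖ * Real.exp (‖w - z‖ / 4) := by
  have hderiv (x : ℂ) : HasDerivAt (weightedJet k g)
      (fun j : Fin k => 4 ^ (j : ℕ) * iteratedDeriv (j + 1) g x) x :=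
    hasDerivAt_pi.2 fun j => (hg.hasDerivAt_iteratedDeriv j x).const_mul _
  have hbound (x : ℂ) (hx : x.re ≤ X) :
      ‖fun j : Fin k => (4 : ℂ) ^ (j : ℕ) * iteratedDeriv (j + 1) g x‖
        ≤ 1 / 4 * ‖weightedJet k g x‖ := by
    refine (pi_norm_le_iff_of_nonneg (by positivity)).2 fun j => ?_
    rcases (Nat.succ_le_of_lt j.2).lt_or_eq with hj | hj
    · have h := norm_le_pi_norm (weightedJet k g x) ⟨j + 1, hj⟩
      simp only [weightedJet, norm_mul, norm_pow, Complex.norm_ofNat, pow_succ] at h ⊢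
      linarith
    · have h := norm_le_pi_norm (weightedJet k g x) ⟨0, j.pos⟩
      simp only [weightedJet, pow_zero, one_mul, iteratedDeriv_zero] at h
      have hj' : (j : ℕ) + 1 = k := hj
      rw [hj', hode]
      have hq : 4 ^ k * ((k : ℝ) ^ k * Real.exp (k * x.re)) ≤ 1 := by
        rw [Real.exp_nat_mul, ← mul_pow, ← mul_pow, ← mul_assoc]
        refine pow_le_one₀ (by positivity) (le_trans ?_ hX)
        gcongr
      have h4 : (4 : ℝ) ^ k = 4 ^ (j : ℕ) * 4 := by rw [← pow_succ, hj']
      rw [h4] at hq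
      simp only [norm_mul, norm_pow, Complex.norm_ofNat, Complex.norm_natCast, Complex.norm_exp,
        Complex.mul_re, Complex.natCast_re, Complex.natCast_im, zero_mul, sub_zero]
      calc (4 : ℝ) ^ (j : ℕ) * ((k : ℝ) ^ k * Real.exp (k * x.re) * ‖g x‖)
          = (4 ^ (j : ℕ) * 4 * ((k : ℝ) ^ k * Real.exp (k * x.re))) / 4 * ‖g x‖ := by ring
        _ ≤ 1 / 4 * ‖weightedJet k g x‖ := by gcongr
  have hpath (t : ℝ) : HasDerivAt (fun t : ℝ => z + t * (w - z)) (w - z) t := by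
    simpa using (((hasDerivAt_id t).ofReal_comp).mul_const (w - z)).const_add z
  have hF (t : ℝ) := (hderiv (z + t * (w - z))).scomp t (hpath t)
  have hgr := norm_le_gronwallBound_of_norm_deriv_right_le (a := 0) (b := 1)
    (K := ‖w - z‖ / 4) (ε := 0)
    (fun t _ => (hF t).continuousAt.continuousWithinAt)
    (fun t _ => (hF t).hasDerivWithinAt) le_rfl (fun t ht => ?_) 1 (by simp)
  · simpa [gronwallBound_ε0] using hgr
  · have hre : (z + t * (w - z)).re ≤ X := by
      simp only [Complex.add_re, Complex.re_ofReal_mul, Complex.sub_re]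
      nlinarith [ht.1, ht.2]
    rw [norm_smul, add_zero]
    calc _ ≤ ‖w - z‖ * (1 / 4 * ‖weightedJet k g (z + t * (w - z))‖) := by
          gcongr
          exact hbound _ hre
      _ = _ := by simp only [Function.comp_apply]; ring

lemma norm_le_norm_weightedJet {k : ℕ} (hk : 1 ≤ k) (g : ℂ → ℂ) (x : ℂ) :
    ‖g x‖ ≤ ‖weightedJet k g x‖ := by
  simpa [weightedJet] using norm_le_pi_norm (weightedJet k g x) ⟨0, hk⟩

/-- Forward differences along a period of `exp (k x)` preserve the hypergeometric equation. -/
lemma hypergeometric_fwdDiff_iterate {k : ℕ} {g : ℂ → ℂ} (hg : Differentiable ℂ g)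
    (hode : ∀ x : ℂ, iteratedDeriv k g x = (k : ℂ) ^ k * Complex.exp ((k : ℂ) * x) * g x)
    {h : ℂ} (hh : k * h = 2 * π * Complex.I) (n : ℕ) (x : ℂ) :
    iteratedDeriv k ((fwdDiff h)^[n] g) x
      = (k : ℂ) ^ k * Complex.exp ((k : ℂ) * x) * (fwdDiff h)^[n] g x := by
  induction n generalizing x with
  | zero => exact hode x
  | succ n ih =>
    rw [Function.iterate_succ_apply', iteratedDeriv_fwdDiff (hg.fwdDiff_iterate h n)]
    simp only [fwdDiff, ih, mul_add, hh, Complex.exp_add, Complex.exp_two_pi_mul_I]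
    ring

/-- A solution which decays like `exp (s * (1/4 - k))` along unit discs moving to the left
vanishes. -/
lemma hypergeometric_eq_zero_of_decay {k : ℕ} (hk : 1 ≤ k) {g : ℂ → ℂ} (hg : Differentiable ℂ g)
    (hode : ∀ x : ℂ, iteratedDeriv k g x = (k : ℂ) ^ k * Complex.exp ((k : ℂ) * x) * g x)
    {z : ℂ} (hz : 4 * k * Real.exp z.re ≤ 1) {C : ℝ}
    (hC : ∀ s : ℝ, 1 ≤ s → ∀ w ∈ Metric.sphere (z - s) 1, ‖g w‖ ≤ C * Real.exp (s * (1 / 4 - k))) :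
    g z = 0 := by
  have hk' : (1 : ℝ) ≤ k := by exact_mod_cast hk
  have hC0 : 0 ≤ C := by
    have h := (norm_nonneg _).trans (hC 1 le_rfl (z - (1 : ℝ) + 1) (by simp))
    exact nonneg_of_mul_nonneg_left h (Real.exp_pos _)
  have hjet (s : ℝ) (hs : 1 ≤ s) : ‖weightedJet k g (z - s)‖
      ≤ 4 ^ k * k.factorial * C * Real.exp (s * (1 / 4 - k)) := by
    refine (pi_norm_le_iff_of_nonneg (by positivity)).2 fun j => ?_
    have h := Complex.norm_iteratedDeriv_le_of_forall_mem_sphere_norm_le j one_pos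
      hg.diffContOnCl (hC s hs)
    rw [one_pow, div_one] at h
    simp only [weightedJet, norm_mul, norm_pow, Complex.norm_ofNat]
    calc _ ≤ (4 : ℝ) ^ (j : ℕ) * ((j : ℕ).factorial * (C * Real.exp (s * (1 / 4 - k)))) := by
          gcongr
      _ ≤ (4 : ℝ) ^ k * (k.factorial * (C * Real.exp (s * (1 / 4 - k)))) := by
          gcongr
          · norm_num
          · exact j.2.le
          · exact j.2.le
      _ = _ := by ring
  have hle (s : ℝ) (hs : 1 ≤ s) :
      ‖g z‖ ≤ 4 ^ k * k.factorial * C * Real.exp (-(s / 2)) := by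
    have h := norm_weightedJet_le hg hode hz (z := z - s) (w := z) (by simp; linarith) le_rfl
    have hn : ‖z - (z - s)‖ = s := by
      rw [sub_sub_cancel, Complex.norm_real, Real.norm_of_nonneg (by linarith)]
    rw [hn] at h
    calc ‖g z‖ ≤ _ := norm_le_norm_weightedJet hk g z
      _ ≤ _ := h
      _ ≤ 4 ^ k * k.factorial * C * Real.exp (s * (1 / 4 - k)) * Real.exp (s / 4) := by
          gcongr
          exact hjet s hs
      _ = 4 ^ k * k.factorial * C * Real.exp (s * (1 / 4 - k) + s / 4) := by
          rw [Real.exp_add, mul_assoc]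
      _ ≤ _ := by
          gcongr
          nlinarith
  have hlim : Filter.Tendsto (fun s : ℝ => 4 ^ k * k.factorial * C * Real.exp (-(s / 2)))
      Filter.atTop (nhds 0) := by
    simpa using (Real.tendsto_exp_neg_atTop_nhds_zero.comp
      (Filter.tendsto_id.atTop_div_const (by norm_num : (0 : ℝ) < 2))).const_mul
      (4 ^ k * k.factorial * C : ℝ)
  refine norm_le_zero_iff.1 (ge_of_tendsto hlim ?_)
  filter_upwards [Filter.eventually_ge_atTop 1] with s hs using hle s hs

lemma hypergeometric_fwdDiff_iterate_eq_zero_of_re_le {k : ℕ} (hk : 1 ≤ k) {g : ℂ → ℂ}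
    (hg : Differentiable ℂ g)
    (hode : ∀ x : ℂ, iteratedDeriv k g x = (k : ℂ) ^ k * Complex.exp ((k : ℂ) * x) * g x)
    {h : ℂ} (hh : k * h = 2 * π * Complex.I) {z : ℂ} (hz : 4 * k * Real.exp z.re ≤ 1) :
    (fwdDiff h)^[k] g z = 0 := by
  have hk0 : (0 : ℝ) < k := by exact_mod_cast hk
  have hre : h.re = 0 := by
    have := congrArg Complex.re hh
    simpa [hk0.ne', Nat.pos_iff_ne_zero.1 hk] using this
  refine hypergeometric_eq_zero_of_decay hk (hg.fwdDiff_iterate h k)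
    (hypergeometric_fwdDiff_iterate hg hode hh k) hz
    (C := (k : ℝ) ^ k * Real.exp (k * (z.re + 1)) *
      (‖weightedJet k g z‖ * Real.exp ((1 + k * ‖h‖) / 4)) * ‖h‖ ^ k) fun s hs w hw => ?_
  rw [mem_sphere_iff_norm] at hw
  have hwre : w.re ≤ z.re - s + 1 := by
    have := (Complex.re_le_norm (w - (z - s))).trans_eq hw
    simp at this
    linarith
  refine (norm_fwdDiff_iterate_le hg h w k
    (M := (k : ℝ) ^ k * Real.exp (k * (z.re - s + 1)) *
      (‖weightedJet k g z‖ * Real.exp ((s + 1 + k * ‖h‖) / 4))) fun t ht => ?_).trans_eq ?_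
  · have hre' : (w + t * h).re = w.re := by simp [hre]
    have hdist : ‖w + t * h - z‖ ≤ s + 1 + k * ‖h‖ := by
      calc ‖w + t * h - z‖ = ‖(w - (z - s)) + (-s : ℂ) + t * h‖ := by congr 1; ring
        _ ≤ ‖w - (z - s)‖ + ‖(-s : ℂ)‖ + ‖t * h‖ := norm_add₃_le
        _ ≤ s + 1 + k * ‖h‖ := by
          rw [hw, norm_neg, norm_mul, Complex.norm_real, Complex.norm_real,
            Real.norm_of_nonneg ht.1, Real.norm_of_nonneg (by linarith)]
          have := mul_le_mul_of_nonneg_right ht.2 (norm_nonneg h)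
          linarith
    have hg' := (norm_le_norm_weightedJet hk g (w + t * h)).trans
      (norm_weightedJet_le hg hode hz (z := z) le_rfl (by rw [hre']; linarith))
    rw [hode, norm_mul, norm_mul, norm_pow, Complex.norm_natCast, Complex.norm_exp]
    simp only [Complex.mul_re, Complex.natCast_re, Complex.natCast_im, zero_mul, sub_zero, hre']
    gcongr
    exact hg'.trans (by gcongr)
  · have h1 : Real.exp (k * (z.re - s + 1)) * Real.exp ((s + 1 + k * ‖h‖) / 4)
        = Real.exp (k * (z.re + 1)) * Real.exp ((1 + k * ‖h‖) / 4)
          * Real.exp (s * (1 / 4 - k)) := by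
      rw [← Real.exp_add, ← Real.exp_add, ← Real.exp_add]
      ring_nf
    linear_combination (k : ℝ) ^ k * ‖weightedJet k g z‖ * ‖h‖ ^ k * h1

/-- The monodromy of the hypergeometric equation is unipotent. -/
lemma hypergeometric_fwdDiff_iterate_eq_zero {k : ℕ} (hk : 1 ≤ k) {g : ℂ → ℂ}
    (hg : Differentiable ℂ g)
    (hode : ∀ x : ℂ, iteratedDeriv k g x = (k : ℂ) ^ k * Complex.exp ((k : ℂ) * x) * g x)
    {h : ℂ} (hh : k * h = 2 * π * Complex.I) : (fwdDiff h)^[k] g = 0 := by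
  have han : AnalyticOnNhd ℂ ((fwdDiff h)^[k] g) Set.univ := fun x _ =>
    (hg.fwdDiff_iterate h k).analyticAt x
  have hlim : Filter.Tendsto (fun x : ℝ => 4 * k * Real.exp x) Filter.atBot (nhds 0) := by
    simpa using Real.tendsto_exp_atBot.const_mul (4 * k : ℝ)
  obtain ⟨X, hX⟩ := (hlim.eventually (gt_mem_nhds one_pos)).exists
  refine han.eq_of_eventuallyEq (z₀ := (X : ℂ)) analyticOnNhd_const ?_
  have hcont : ContinuousAt (fun z : ℂ => 4 * k * Real.exp z.re) (X : ℂ) := by fun_prop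
  filter_upwards [hcont.eventually (gt_mem_nhds (by simpa using hX))] with z hz
  exact hypergeometric_fwdDiff_iterate_eq_zero_of_re_le hk hg hode hh hz.le

/-- **Identity (13) of the paper (Lemma 5, part (e)).** Every entire solution of the
generalized hypergeometric equation `φ^{(k)}(x) = k^k e^{kx} φ(x)` (the equation
`(z d/dz)^k φ = (kz)^k φ` in the logarithmic coordinate `x = log z`) satisfies
`Σ_{m=0}^{k} (-1)^m·C(k,m)·φ(x + 2πim/k) = 0`; i.e. the monodromy operator
`(Aφ)(x) = φ(x + 2πi/k)` is unipotent. -/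
theorem hypergeometric_monodromy_identity (k : ℕ) (hk : 1 ≤ k) (φ : ℂ → ℂ)
    (hφ : Differentiable ℂ φ)
    (hode : ∀ x : ℂ, iteratedDeriv k φ x = (k : ℂ) ^ k * Complex.exp ((k : ℂ) * x) * φ x) :
    ∀ x : ℂ, ∑ m ∈ Finset.range (k + 1),
      (-1 : ℂ) ^ m * (k.choose m : ℂ) * φ (x + 2 * (π : ℂ) * Complex.I * m / k) = 0 := by
  have hk0 : (k : ℂ) ≠ 0 := by exact_mod_cast (Nat.pos_iff_ne_zero.1 hk)
  intro x
  have h := congrFun (hypergeometric_fwdDiff_iterate_eq_zero hk hφ hode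
    (mul_div_cancel₀ (2 * (π : ℂ) * Complex.I) hk0)) x
  rw [fwdDiff_iter_eq_sum_shift] at h
  have h' := congrArg ((-1 : ℂ) ^ k * ·) h
  simp only [Pi.zero_apply, mul_zero, Finset.mul_sum] at h'
  rw [← h']
  refine Finset.sum_congr rfl fun m hm => ?_
  have hmk : m ≤ k := Nat.lt_succ_iff.1 (Finset.mem_range.1 hm)
  have hsign : (-1 : ℂ) ^ k * (-1) ^ (k - m) = (-1) ^ m := by
    obtain ⟨d, rfl⟩ := Nat.exists_eq_add_of_le hmk
    rw [Nat.add_sub_cancel_left, pow_add, mul_assoc, ← mul_pow]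
    simp
  have harg : x + m • (2 * (π : ℂ) * Complex.I / k) = x + 2 * (π : ℂ) * Complex.I * m / k := by
    rw [nsmul_eq_mul]
    ring
  rw [harg, zsmul_eq_mul, ← hsign]
  push_cast
  ring
end

section
/- There exists a unique family of complex numbers (a_{ij}) indexed by pairs 1 ≤ i < j ≤ k such that for every pair i < j: S_{ij} = Σ over all admissible sequences i = c₀ < c₁ < ⋯ < c_r = j of the products a_{c₀ c₁}·a_{c₁ c₂}·⋯·a_{c_{r−1} c_r}. -/
open scoped Classical

/-- The product `a_{c₀c₁}·a_{c₁c₂}·⋯·a_{c_{r-1}c_r}` along the strictly increasing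
sequence enumerating the finite set `C`. -/
noncomputable def chainProd {k : ℕ} (a : Fin k → Fin k → ℂ) (C : Finset (Fin k)) : ℂ :=
  (((C.sort (· ≤ ·)).zip (C.sort (· ≤ ·)).tail).map fun p => a p.1 p.2).prod

/-- The admissible sequences `i = c₀ < c₁ < ⋯ < c_r = j` (encoded by their underlying sets):
all entries lie between `i` and `j`, the endpoints are `i` and `j`, and every intermediate
index has 1-based parity equal to the parity of `k` (even when `k` is even, odd when `k`
is odd). -/
noncomputable def admissibleChains (k : ℕ) (i j : Fin k) : Finset (Finset (Fin k)) :=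
  Finset.univ.filter fun C =>
    i ∈ C ∧ j ∈ C ∧ (∀ x ∈ C, i ≤ x ∧ x ≤ j) ∧
      ∀ x ∈ C, x ≠ i → x ≠ j → (x.val + 1) % 2 = k % 2

theorem List.Pairwise.lt_of_mem_zip_tail {α : Type*} [LinearOrder α] {l : List α}
    (hl : l.Pairwise (· < ·)) {p q : α} (h : (p, q) ∈ l.zip l.tail) :
    p ∈ l ∧ q ∈ l ∧ p < q ∧ ∀ x ∈ l, x ≤ p ∨ q ≤ x := by
  induction l with
  | nil => simp at h
  | cons u l ih =>
    cases l with
    | nil => simp at h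
    | cons v l =>
      rw [List.pairwise_cons] at hl
      simp only [List.tail_cons, List.zip_cons_cons, List.mem_cons, Prod.mk.injEq] at h
      rcases h with ⟨rfl, rfl⟩ | h
      · refine ⟨by simp, by simp, hl.1 _ (by simp), fun x hx => ?_⟩
        rcases List.mem_cons.1 hx with rfl | hx
        · exact Or.inl le_rfl
        · rcases List.mem_cons.1 hx with rfl | hx
          · exact Or.inr le_rfl
          · exact Or.inr ((List.pairwise_cons.1 hl.2).1 x hx).le
      · obtain ⟨hp, hq, hpq, hx⟩ := ih hl.2 h
        refine ⟨List.mem_cons_of_mem _ hp, List.mem_cons_of_mem _ hq, hpq, fun x hxm => ?_⟩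
        rcases List.mem_cons.1 hxm with rfl | hxm
        · exact Or.inl (hl.1 p hp).le
        · exact hx x hxm

theorem chainProd_pair {k : ℕ} (a : Fin k → Fin k → ℂ) {i j : Fin k} (h : i < j) :
    chainProd a {i, j} = a i j := by
  have hs : ({i, j} : Finset (Fin k)).sort (· ≤ ·) = [i, j] := by
    rw [Finset.sort_insert _ (by simpa using h.le) (by simpa using h.ne),
      Finset.sort_singleton]
  simp [chainProd, hs]

theorem pair_mem_admissibleChains {k : ℕ} {i j : Fin k} (h : i < j) :
    {i, j} ∈ admissibleChains k i j := by
  simp only [admissibleChains, Finset.mem_filter, Finset.mem_univ, Finset.mem_insert,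
    Finset.mem_singleton, true_and]
  grind

/-- A chain from `i` to `j` with an intermediate index only has steps shorter than `j - i`. -/
theorem chainProd_congr {k : ℕ} {a b : Fin k → Fin k → ℂ} {i j : Fin k}
    (hab : ∀ p q : Fin k, p < q → q.val - p.val < j.val - i.val → a p q = b p q)
    {C : Finset (Fin k)} (hC : C ∈ (admissibleChains k i j).erase {i, j}) :
    chainProd a C = chainProd b C := by
  simp only [admissibleChains, Finset.mem_erase, Finset.mem_filter, Finset.mem_univ,
    true_and] at hC
  obtain ⟨hne, hi, hj, hbd, -⟩ := hC
  unfold chainProd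
  congr 1
  refine List.map_congr_left fun ⟨p, q⟩ hpq => ?_
  obtain ⟨hp, hq, hlt, hgap⟩ :=
    List.Pairwise.lt_of_mem_zip_tail (Finset.sortedLT_sort C).pairwise hpq
  simp only [Finset.mem_sort] at hp hq hgap
  refine hab p q hlt ?_
  have hpi := (hbd p hp).1
  have hqj := (hbd q hq).2
  have hends : ¬ (p = i ∧ q = j) := by
    rintro ⟨rfl, rfl⟩
    refine hne (Finset.ext fun x => ?_)
    simp only [Finset.mem_insert, Finset.mem_singleton]
    refine ⟨fun hx => (hgap x hx).imp (fun h => le_antisymm h (hbd x hx).1)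
      fun h => le_antisymm (hbd x hx).2 h, ?_⟩
    rintro (rfl | rfl) <;> assumption
  simp only [Fin.ext_iff, Fin.lt_def, Fin.le_def] at *
  omega

theorem sum_admissibleChains {k : ℕ} (a : Fin k → Fin k → ℂ) {i j : Fin k} (h : i < j) :
    ∑ C ∈ admissibleChains k i j, chainProd a C =
      a i j + ∑ C ∈ (admissibleChains k i j).erase {i, j}, chainProd a C := by
  rw [← Finset.add_sum_erase _ _ (pair_mem_admissibleChains h), chainProd_pair a h]

/-- The Stokes factor entries, obtained by recursion on `j - i`. -/
noncomputable def stokesFactor {k : ℕ} (S : Matrix (Fin k) (Fin k) ℂ) (i j : Fin k) : ℂ :=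
  if i < j then
    S i j - ∑ C ∈ (admissibleChains k i j).erase {i, j},
      chainProd (fun p q => if _h : q.val - p.val < j.val - i.val then stokesFactor S p q else 0) C
  else 0
termination_by j.val - i.val

/-- **Lemma 9 of the paper.** For an upper unitriangular matrix `S` there is a unique
family `(a_{ij})_{i<j}` such that every entry `S_{ij}` (`i < j`) is the sum, over all
admissible sequences `i = c₀ < c₁ < ⋯ < c_r = j`, of the products
`a_{c₀c₁}·a_{c₁c₂}·⋯·a_{c_{r-1}c_r}`. -/
theorem stokes_factorization_unique (k : ℕ) (hk : 2 ≤ k)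
    (S : Matrix (Fin k) (Fin k) ℂ)
    (hdiag : ∀ i, S i i = 1) (hlow : ∀ i j : Fin k, j < i → S i j = 0) :
    ∃! a : Fin k → Fin k → ℂ,
      (∀ i j : Fin k, ¬ i < j → a i j = 0) ∧
      ∀ i j : Fin k, i < j →
        S i j = ∑ C ∈ admissibleChains k i j, chainProd a C := by
  refine ⟨stokesFactor S, ⟨fun i j h => ?_, fun i j h => ?_⟩, fun b ⟨hb₀, hb⟩ => ?_⟩
  · rw [stokesFactor, if_neg h]
  · rw [sum_admissibleChains _ h, stokesFactor, if_pos h, sub_add_eq_add_sub, eq_sub_iff_add_eq]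
    congr 1
    refine Finset.sum_congr rfl fun C hC => chainProd_congr (fun p q _ hpq => ?_) hC
    rw [dif_pos hpq]
  · suffices H : ∀ n : ℕ, ∀ i j : Fin k, j.val - i.val = n → b i j = stokesFactor S i j from
      funext₂ fun i j => H _ i j rfl
    intro n
    induction n using Nat.strong_induction_on with
    | _ n ih =>
      rintro i j rfl
      rw [stokesFactor]
      split_ifs with h
      · rw [hb i j h, sum_admissibleChains _ h, eq_sub_iff_add_eq]
        congr 1
        refine Finset.sum_congr rfl fun C hC => chainProd_congr (fun p q _ hpq => ?_) hC
        rw [dif_pos hpq, ih _ hpq p q rfl]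
      · exact hb₀ i j h
end

section
/- For every integer k ≥ 3, the subgroup of PSL(2, ℝ) generated by the images of the SL(2, ℝ) matrices [[0, −1], [1, 0]] and [[0, 1], [−1, 2·cos(π/k)]] — i.e. by the Möbius transformations τ ↦ −1/τ and τ ↦ 1/(2·cos(π/k) − τ) of the upper half-plane — is isomorphic, as an abstract group, to the free product (ℤ/2ℤ) ∗ (ℤ/kℤ), the group ⟨X, Y | X² = Y^k = 1⟩ of orientation-preserving transformations of the hyperbolic triangle group [2, k, ∞]. -/
open Matrix Real
open scoped MatrixGroups

universe u

/-- **Ping-pong lemma** for the binary free product of the members of a family indexed by `Bool`. -/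
theorem Monoid.Coprod.lift_injective_of_ping_pong_bool {H : Bool → Type*} {G α : Type*}
    [∀ b, Group (H b)] [Group G] [MulAction G α] (F : ∀ b, H b →* G)
    (hcard : 3 ≤ Cardinal.mk (H true))
    {X Y : Set α} (hX : X.Nonempty) (hY : Y.Nonempty) (hXY : Disjoint X Y)
    (hf : ∀ m, m ≠ 1 → ∀ y ∈ Y, F false m • y ∈ X)
    (hg : ∀ n, n ≠ 1 → ∀ x ∈ X, F true n • x ∈ Y) :
    Function.Injective (Monoid.Coprod.lift (F false) (F true)) := by
  let toI : Monoid.Coprod (H false) (H true) →* Monoid.CoprodI H :=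
    Monoid.Coprod.lift Monoid.CoprodI.of Monoid.CoprodI.of
  let ofI : Monoid.CoprodI H →* Monoid.Coprod (H false) (H true) :=
    Monoid.CoprodI.lift fun
      | false => Monoid.Coprod.inl
      | true => Monoid.Coprod.inr
  have hleft : ofI.comp toI = MonoidHom.id _ := by
    apply Monoid.Coprod.hom_ext <;> ext <;> simp [ofI, toI]
  have hfactor : Monoid.Coprod.lift (F false) (F true) = (Monoid.CoprodI.lift F).comp toI := by
    apply Monoid.Coprod.hom_ext <;> ext <;> simp [toI]
  rw [hfactor, MonoidHom.coe_comp]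
  refine Function.Injective.comp ?_
    (Function.LeftInverse.injective (g := ofI) fun x => DFunLike.congr_fun hleft x)
  refine Monoid.CoprodI.lift_injective_of_ping_pong F (Or.inr ⟨true, hcard⟩)
    (fun b => Bool.rec X Y b) ?_ ?_ ?_
  · rintro (_ | _)
    exacts [hX, hY]
  · rintro (_ | _) (_ | _) hij
    exacts [absurd rfl hij, hXY, hXY.symm, absurd rfl hij]
  · rintro (_ | _) (_ | _) hij h hh
    · exact absurd rfl hij
    · exact Set.image_subset_iff.mpr (hf h hh)
    · exact Set.image_subset_iff.mpr (hg h hh)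
    · exact absurd rfl hij

/-- **Ping-pong lemma** for the free product of two groups. -/
theorem Monoid.Coprod.lift_injective_of_ping_pong {M N : Type u} {G α : Type*} [Group M] [Group N]
    [Group G] [MulAction G α] (f : M →* G) (g : N →* G) (hcard : 3 ≤ Cardinal.mk N)
    {X Y : Set α} (hX : X.Nonempty) (hY : Y.Nonempty) (hXY : Disjoint X Y)
    (hf : ∀ m, m ≠ 1 → ∀ y ∈ Y, f m • y ∈ X) (hg : ∀ n, n ≠ 1 → ∀ x ∈ X, g n • x ∈ Y) :
    Function.Injective (Monoid.Coprod.lift f g) := by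
  obtain ⟨H, rfl, rfl⟩ : ∃ H : Bool → Type u, H false = M ∧ H true = N :=
    ⟨fun b => cond b N M, rfl, rfl⟩
  let groupH : ∀ b, Group (H b) := fun b => Bool.rec ‹Group (H false)› ‹Group (H true)› b
  let F : ∀ b, H b →* G := fun b => Bool.rec (motive := fun b => H b →* G) f g b
  exact Monoid.Coprod.lift_injective_of_ping_pong_bool F hcard hX hY hXY hf hg

/-- An element `a` with `a ^ n = 1` defines a homomorphism from the cyclic group of order `n`
whose range is the subgroup generated by `a`. -/
theorem exists_zmodHom_of_pow_eq_one {G : Type*} [Group G] {n : ℕ} {a : G} (ha : a ^ n = 1) :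
    ∃ f : Multiplicative (ZMod n) →* G,
      (∀ j : ℕ, f (Multiplicative.ofAdd (j : ZMod n)) = a ^ j) ∧
      f.range = Subgroup.zpowers a := by
  let φ : ZMod n →+ Additive G :=
    ZMod.lift n ⟨(zmultiplesHom (Additive G)) (Additive.ofMul a), by
      simp [← ofMul_pow, ha]⟩
  have hφ : ∀ j : ℤ, φ (j : ZMod n) = Additive.ofMul (a ^ j) := fun j => by simp [φ]
  refine ⟨AddMonoidHom.toMultiplicativeLeft φ, fun j => ?_, ?_⟩
  · have h := hφ j
    rw [Int.cast_natCast, zpow_natCast] at h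
    exact congrArg Additive.toMul h
  · ext x
    constructor
    · rintro ⟨y, rfl⟩
      obtain ⟨j, hj⟩ := ZMod.intCast_surjective y.toAdd
      refine ⟨j, ?_⟩
      have h := hφ j
      rw [hj] at h
      exact congrArg Additive.toMul h.symm
    · rintro ⟨j, rfl⟩
      exact ⟨Multiplicative.ofAdd (j : ZMod n), congrArg Additive.toMul (hφ j)⟩

/-- Powers of `[[0, 1], [-1, 2 cos θ]]`, cleared of the denominator `sin θ`. -/
theorem sin_smul_pow_eq (θ : ℝ) (n : ℕ) :
    Real.sin θ • (!![0, 1; -1, 2 * Real.cos θ] : Matrix (Fin 2) (Fin 2) ℝ) ^ n =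
      !![-Real.sin ((n - 1) * θ), Real.sin (n * θ); -Real.sin (n * θ), Real.sin ((n + 1) * θ)] := by
  induction n with
  | zero =>
    ext i j
    fin_cases i <;> fin_cases j <;> simp
  | succ n ih =>
    have h₁ : Real.sin ((n + 1 + 1) * θ) =
        -Real.sin (n * θ) + Real.sin ((n + 1) * θ) * (2 * Real.cos θ) := by
      have e₁ : ((n : ℝ) + 1 + 1) * θ = (n + 1) * θ + θ := by ring
      have e₂ : (n : ℝ) * θ = (n + 1) * θ - θ := by ring
      rw [e₁, e₂, Real.sin_add, Real.sin_sub]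
      ring
    have h₀ : Real.sin ((n + 1) * θ) =
        -Real.sin ((n - 1) * θ) + Real.sin (n * θ) * (2 * Real.cos θ) := by
      have e₁ : ((n : ℝ) + 1) * θ = n * θ + θ := by ring
      have e₂ : ((n : ℝ) - 1) * θ = n * θ - θ := by ring
      rw [e₁, e₂, Real.sin_add, Real.sin_sub]
      ring
    rw [pow_succ, ← smul_mul_assoc, ih]
    push_cast
    rw [h₁]
    ext i j
    fin_cases i <;> fin_cases j <;> simp [Matrix.mul_apply, Fin.sum_univ_two]
    exact h₀.symm

/-- The classes in `PSL(2, ℝ)` of the matrices whose first column `(x, y)` satisfies `0 < ε x y`. -/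
def columnSignSet (ε : ℝ) : Set PSL(2, ℝ) :=
  {p | ∃ g : SL(2, ℝ), QuotientGroup.mk' (Subgroup.center SL(2, ℝ)) g = p ∧
    0 < ε * ((g : Matrix (Fin 2) (Fin 2) ℝ) 0 0 * (g : Matrix (Fin 2) (Fin 2) ℝ) 1 0)}

theorem Matrix.SpecialLinearGroup.mk_neg (g : SL(2, ℝ)) :
    QuotientGroup.mk' (Subgroup.center SL(2, ℝ)) (-g) = QuotientGroup.mk' _ g := by
  refine ((QuotientGroup.mk'_eq_mk' _).2 ⟨-1, ?_, by simp⟩)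
  rw [Subgroup.mem_center_iff]
  intro h
  simp

theorem columnSignSet_disjoint : Disjoint (columnSignSet (-1)) (columnSignSet 1) := by
  rw [Set.disjoint_left]
  rintro p ⟨g, hg, hneg⟩ ⟨h, hh, hpos⟩
  obtain ⟨z, hz, rfl⟩ := (QuotientGroup.mk'_eq_mk' _).1 (hg.trans hh.symm)
  obtain ⟨r, -, hr⟩ := Matrix.SpecialLinearGroup.mem_center_iff.1 hz
  simp [← hr, Matrix.mul_apply, Fin.sum_univ_two] at hneg hpos
  nlinarith [sq_nonneg r]

theorem columnSignSet_nonempty (ε : ℝ) (hε : ε ≠ 0) : (columnSignSet ε).Nonempty := by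
  refine ⟨_, ⟨!![1, 0; ε, 1], by simp [Matrix.det_fin_two]⟩, rfl, ?_⟩
  simpa using hε

/-- **Lemma 10 of the paper.** The subgroup of `PSL(2,ℝ)` generated by the images of the
`SL(2,ℝ)` matrices `[[0,-1],[1,0]]` and `[[0,1],[-1,2cos(π/k)]]` — i.e. by the Möbius
transformations `τ ↦ -1/τ` and `τ ↦ 1/(2cos(π/k) - τ)` of the upper half-plane — is
isomorphic to the free product `C₂ ∗ C_k`, the group `⟨X, Y | X² = Y^k = 1⟩` of
orientation-preserving transformations of the hyperbolic triangle group `[2,k,∞]`. -/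
theorem triangle_group_generators (k : ℕ) (hk : 3 ≤ k)
    (A B : Matrix.SpecialLinearGroup (Fin 2) ℝ)
    (hA : (A : Matrix (Fin 2) (Fin 2) ℝ) = !![0, -1; 1, 0])
    (hB : (B : Matrix (Fin 2) (Fin 2) ℝ) = !![0, 1; -1, 2 * Real.cos (π / k)]) :
    Nonempty ((Subgroup.closure
        ({QuotientGroup.mk' (Subgroup.center (Matrix.SpecialLinearGroup (Fin 2) ℝ)) A,
          QuotientGroup.mk' (Subgroup.center (Matrix.SpecialLinearGroup (Fin 2) ℝ)) B} :
          Set PSL(2, ℝ)) : Subgroup PSL(2, ℝ)) ≃*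
      Monoid.Coprod (Multiplicative (ZMod 2)) (Multiplicative (ZMod k))) := by
  have hk0 : (0 : ℝ) < k := by positivity
  have hsin : 0 < Real.sin (π / k) := by
    apply Real.sin_pos_of_pos_of_lt_pi (by positivity)
    apply div_lt_self Real.pi_pos
    exact_mod_cast (by lia : 1 < k)
  have hA2 : A ^ 2 = -1 := by
    ext i j
    fin_cases i <;> fin_cases j <;>
      simp [pow_two, hA, Matrix.mul_apply, Fin.sum_univ_two]
  have hBk : B ^ k = -1 := by
    have h := sin_smul_pow_eq (π / k) k
    have e : (k : ℝ) * (π / k) = π := by field_simp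
    rw [sub_mul, add_mul, e, one_mul, Real.sin_pi_sub, add_comm, Real.sin_add_pi,
      Real.sin_pi, ← hB] at h
    ext i j
    have hij := congrFun (congrFun h i) j
    apply mul_left_cancel₀ hsin.ne'
    fin_cases i <;> fin_cases j <;> simpa using hij
  set q := QuotientGroup.mk' (Subgroup.center SL(2, ℝ)) with hq
  have hqneg : q (-1) = 1 := by
    rw [hq, Matrix.SpecialLinearGroup.mk_neg, map_one]
  obtain ⟨f, hf, hfr⟩ := exists_zmodHom_of_pow_eq_one (a := q A) (n := 2)
    (by rw [← map_pow, hA2, hqneg])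
  obtain ⟨g, hg, hgr⟩ := exists_zmodHom_of_pow_eq_one (a := q B) (n := k)
    (by rw [← map_pow, hBk, hqneg])
  have hinj : Function.Injective (Monoid.Coprod.lift f g) := by
    refine Monoid.Coprod.lift_injective_of_ping_pong f g ?_
      (columnSignSet_nonempty (-1) (by norm_num)) (columnSignSet_nonempty 1 one_ne_zero)
      columnSignSet_disjoint ?_ ?_
    · have : NeZero k := ⟨by lia⟩
      change 3 ≤ Cardinal.mk (ZMod k)
      rw [Cardinal.mk_fintype, ZMod.card]
      exact_mod_cast hk
    · rintro m hm _ ⟨h, rfl, hpos⟩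
      have hfm : f m = q A := by
        have hm1 : m = Multiplicative.ofAdd ((1 : ℕ) : ZMod 2) := by
          revert m
          decide
        rw [hm1, hf, pow_one]
      refine ⟨A * h, by rw [hfm, map_mul]; rfl, ?_⟩
      simp [hA, Matrix.mul_apply, Fin.sum_univ_two] at hpos ⊢
      linarith
    · rintro m hm _ ⟨h, rfl, hpos⟩
      have : NeZero k := ⟨by lia⟩
      obtain ⟨n, hn, hnm⟩ : ∃ n < k, m = Multiplicative.ofAdd (n : ZMod k) :=
        ⟨m.toAdd.val, ZMod.val_lt _, by simp⟩
      have hn0 : 1 ≤ n := by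
        rw [Nat.one_le_iff_ne_zero]
        rintro rfl
        exact hm (by simpa using hnm)
      refine ⟨B ^ n * h, by rw [hnm, hg, map_mul, map_pow]; rfl, ?_⟩
      have hangle : ∀ t : ℝ, t ≤ k → t * (π / k) ≤ π := fun t ht => by
        rw [mul_div_assoc', div_le_iff₀ hk0, mul_comm]
        gcongr
      have hn0' : (1 : ℝ) ≤ n := by exact_mod_cast hn0
      have hnk : (n : ℝ) + 1 ≤ k := by exact_mod_cast hn
      have hs : 0 < Real.sin (n * (π / k)) := by
        apply Real.sin_pos_of_pos_of_lt_pi (by positivity)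
        have := hangle (n + 1) hnk
        have : 0 < π / k := by positivity
        linarith
      have hs₀ : 0 ≤ Real.sin ((n - 1) * (π / k)) :=
        Real.sin_nonneg_of_nonneg_of_le_pi
          (mul_nonneg (by linarith) (by positivity)) (hangle _ (by linarith))
      have hs₁ : 0 ≤ Real.sin ((n + 1) * (π / k)) :=
        Real.sin_nonneg_of_nonneg_of_le_pi (by positivity) (hangle _ hnk)
      have hpow := sin_smul_pow_eq (π / k) n
      rw [← hB] at hpow
      have h₀₀ := congrFun (congrFun hpow 0) 0
      have h₀₁ := congrFun (congrFun hpow 0) 1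
      have h₁₀ := congrFun (congrFun hpow 1) 0
      have h₁₁ := congrFun (congrFun hpow 1) 1
      simp only [Matrix.smul_apply, smul_eq_mul, Matrix.of_apply, Matrix.cons_val',
        Matrix.cons_val_zero, Matrix.cons_val_one, Matrix.cons_val_fin_one] at h₀₀ h₀₁ h₁₀ h₁₁
      simp only [Matrix.SpecialLinearGroup.coe_mul, Matrix.SpecialLinearGroup.coe_pow,
        Matrix.mul_apply, Fin.sum_univ_two, one_mul]
      set P := (B : Matrix (Fin 2) (Fin 2) ℝ) ^ n
      set x := (h : Matrix (Fin 2) (Fin 2) ℝ) 0 0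
      set y := (h : Matrix (Fin 2) (Fin 2) ℝ) 1 0
      set s := Real.sin (π / k)
      have hxy : x * y < 0 := by linarith
      have key : 0 < (s * (P 0 0 * x + P 0 1 * y)) * (s * (P 1 0 * x + P 1 1 * y)) := by
        rw [mul_add, mul_add, ← mul_assoc, ← mul_assoc, ← mul_assoc, ← mul_assoc,
          h₀₀, h₀₁, h₁₀, h₁₁]
        rcases mul_neg_iff.1 hxy with ⟨hx, hy⟩ | ⟨hx, hy⟩
        · apply mul_pos_of_neg_of_neg
          · nlinarith [mul_nonneg hs₀ hx.le, mul_pos hs (neg_pos.2 hy)]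
          · nlinarith [mul_nonneg hs₁ (neg_pos.2 hy).le, mul_pos hs hx]
        · apply mul_pos
          · nlinarith [mul_nonneg hs₀ (neg_pos.2 hx).le, mul_pos hs hy]
          · nlinarith [mul_nonneg hs₁ hy.le, mul_pos hs (neg_pos.2 hx)]
      refine pos_of_mul_pos_right (a := s * s) ?_ (mul_self_nonneg s)
      linarith
  have hrange : (Monoid.Coprod.lift f g).range = Subgroup.closure {q A, q B} := by
    rw [Monoid.Coprod.range_lift, hfr, hgr, Subgroup.zpowers_eq_closure,
      Subgroup.zpowers_eq_closure, ← Subgroup.closure_union, Set.singleton_union]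
  exact ⟨((MonoidHom.ofInjective hinj).trans (MulEquiv.subgroupCongr hrange)).symm⟩
end
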